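/- arXiv:2406.08032 — 3 statements merged into one kernel-verified Lean document; each statement's English description precedes it below -/
import Mathlib

section
/- There exists a constant C > 0 such that for every L > C and every i ∈ {0,1,2}: for each x ∈ G ∖ (2P₀ ∪ 2P_L) the integral ∫_G f_L(y) k_i(y⁻¹x) dλ(y) converges absolutely, and ∫_{G ∖ (2P₀ ∪ 2P_L)} | ∫_G f_L(y) k_i(y⁻¹x) dλ(y) | dρ(x) ≤ C log log L. -/
open Real MeasureTheory Set

noncomputable section

/-- `cosh` of the hyperbolic distance from `p = (x₁, x₂, a)` to the identity `e = (0,0,1)`. -/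
def chD (p : ℝ × ℝ × ℝ) : ℝ :=
  (p.2.2 + (p.2.2)⁻¹ + (p.2.2)⁻¹ * (p.1 ^ 2 + p.2.1 ^ 2)) / 2

/-- The hyperbolic distance `r(p)` from `p` to the identity, i.e. `arcosh (chD p)`. -/
def rD (p : ℝ × ℝ × ℝ) : ℝ := Real.log (chD p + Real.sqrt (chD p ^ 2 - 1))

/-- `|x| = √(x₁² + x₂²)`. -/
def nm (p : ℝ × ℝ × ℝ) : ℝ := Real.sqrt (p.1 ^ 2 + p.2.1 ^ 2)

/-- The kernel `k₁`. -/
def k1 (p : ℝ × ℝ × ℝ) : ℝ :=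
  -(2 * Real.pi ^ 2)⁻¹ * (p.2.2)⁻¹ * p.1 *
    (Real.sinh (rD p) + rD p * Real.cosh (rD p)) / (rD p ^ 2 * Real.sinh (rD p) ^ 3)

/-- The kernel `k₂`. -/
def k2 (p : ℝ × ℝ × ℝ) : ℝ :=
  -(2 * Real.pi ^ 2)⁻¹ * (p.2.2)⁻¹ * p.2.1 *
    (Real.sinh (rD p) + rD p * Real.cosh (rD p)) / (rD p ^ 2 * Real.sinh (rD p) ^ 3)

/-- The kernel `k₀`. -/
def k0 (p : ℝ × ℝ × ℝ) : ℝ :=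
  (2 * Real.pi ^ 2)⁻¹ *
    (-(Real.sinh (rD p) + rD p * Real.cosh (rD p)) +
      (p.2.2)⁻¹ * (Real.cosh (rD p) * Real.sinh (rD p) + rD p)) /
    (rD p ^ 2 * Real.sinh (rD p) ^ 3)

/-- `y⁻¹ · x` in the group `G = ℝ² ⋊ ℝ⁺`. -/
def ginvMul (y x : ℝ × ℝ × ℝ) : ℝ × ℝ × ℝ :=
  ((y.2.2)⁻¹ * (x.1 - y.1), (y.2.2)⁻¹ * (x.2.1 - y.2.1), x.2.2 / y.2.2)

/-- The right Haar measure `ρ`, of density `a⁻¹` w.r.t. Lebesgue measure on `{a > 0}`. -/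
def ρG : Measure (ℝ × ℝ × ℝ) :=
  (volume.restrict {p : ℝ × ℝ × ℝ | 0 < p.2.2}).withDensity
    (fun p => ENNReal.ofReal (p.2.2)⁻¹)

/-- The left Haar measure `λ`, of density `a⁻³` w.r.t. Lebesgue measure on `{a > 0}`. -/
def lG : Measure (ℝ × ℝ × ℝ) :=
  (volume.restrict {p : ℝ × ℝ × ℝ | 0 < p.2.2}).withDensity
    (fun p => ENNReal.ofReal ((p.2.2) ^ 3)⁻¹)

/-- The set `P₀ = [−1,1] × [−1,1] × [e⁻¹, e]`. -/
def P0 : Set (ℝ × ℝ × ℝ) :=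
  {p | p.1 ∈ Icc (-1 : ℝ) 1 ∧ p.2.1 ∈ Icc (-1 : ℝ) 1 ∧
       p.2.2 ∈ Icc (Real.exp (-1)) (Real.exp 1)}

/-- The set `2P₀ = [−2,2] × [−2,2] × [e⁻², e²]`. -/
def twoP0 : Set (ℝ × ℝ × ℝ) :=
  {p | p.1 ∈ Icc (-2 : ℝ) 2 ∧ p.2.1 ∈ Icc (-2 : ℝ) 2 ∧
       p.2.2 ∈ Icc (Real.exp (-2)) (Real.exp 2)}

/-- The set `P_L = [L−1,L+1] × [−1,1] × [e⁻¹, e]`. -/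
def PL (L : ℝ) : Set (ℝ × ℝ × ℝ) :=
  {p | p.1 ∈ Icc (L - 1) (L + 1) ∧ p.2.1 ∈ Icc (-1 : ℝ) 1 ∧
       p.2.2 ∈ Icc (Real.exp (-1)) (Real.exp 1)}

/-- The set `2P_L = [L−2,L+2] × [−2,2] × [e⁻², e²]`. -/
def twoPL (L : ℝ) : Set (ℝ × ℝ × ℝ) :=
  {p | p.1 ∈ Icc (L - 2) (L + 2) ∧ p.2.1 ∈ Icc (-2 : ℝ) 2 ∧
       p.2.2 ∈ Icc (Real.exp (-2)) (Real.exp 2)}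

/-- `f_L = χ_{P_L} − χ_{P₀}`. -/
def fL (L : ℝ) (p : ℝ × ℝ × ℝ) : ℝ :=
  (PL L).indicator 1 p - P0.indicator 1 p

/-- The kernels `k₀, k₁, k₂` indexed by `i ∈ {0,1,2}`. -/
def kk : ℕ → (ℝ × ℝ × ℝ) → ℝ
  | 0 => k0
  | 1 => k1
  | _ => k2

/-- `sinh` of the distance as a function of its `cosh`. -/
def sF (c : ℝ) : ℝ := Real.sqrt (c ^ 2 - 1)
/-- `arcosh`. -/
def rF (c : ℝ) : ℝ := Real.log (c + sF c)
def gF (c : ℝ) : ℝ := (sF c + rF c * c) / (rF c ^ 2 * sF c ^ 3)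
def hF (c : ℝ) : ℝ := (c * sF c + rF c) / (rF c ^ 2 * sF c ^ 3)

lemma sF_nonneg (c : ℝ) : 0 ≤ sF c := Real.sqrt_nonneg _

lemma sF_sq {c : ℝ} (hc : 1 ≤ c) : sF c ^ 2 = c ^ 2 - 1 :=
  Real.sq_sqrt (by nlinarith)

lemma sF_le {c : ℝ} (hc : 1 ≤ c) : sF c ≤ c := by
  have := sF_sq hc
  have := sF_nonneg c
  nlinarith

lemma sinh_rF {c : ℝ} (hc : 1 ≤ c) : Real.sinh (rF c) = sF c := by
  have h0 := sF_nonneg c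
  have hp : 0 < c + sF c := by linarith
  have h1 : (c + sF c)⁻¹ = c - sF c := by
    have := sF_sq hc
    exact inv_eq_of_mul_eq_one_right (by nlinarith)
  rw [rF, Real.sinh_log hp, h1]; ring

lemma cosh_rF {c : ℝ} (hc : 1 ≤ c) : Real.cosh (rF c) = c := by
  have h0 := sF_nonneg c
  have hp : 0 < c + sF c := by linarith
  have h1 : (c + sF c)⁻¹ = c - sF c := by
    have := sF_sq hc
    exact inv_eq_of_mul_eq_one_right (by nlinarith)
  rw [rF, Real.cosh_log hp, h1]; ring

lemma sF_ge {c : ℝ} (hc : 51 / 50 ≤ c) : c / 10 ≤ sF c := by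
  apply Real.le_sqrt_of_sq_le; nlinarith

lemma rF_ge_log {c : ℝ} (hc : 1 ≤ c) : Real.log c ≤ rF c := by
  have h0 := sF_nonneg c
  exact Real.log_le_log (by linarith) (by linarith)

lemma log_ge {c : ℝ} (hc : 51 / 50 ≤ c) : 1 / 60 ≤ Real.log c := by
  have h := Real.one_sub_inv_le_log_of_pos (show 0 < c by linarith)
  have h2 : c⁻¹ ≤ (51 / 50 : ℝ)⁻¹ := inv_anti₀ (by norm_num) hc
  norm_num at h2
  linarith

lemma rF_ge {c : ℝ} (hc : 51 / 50 ≤ c) : 1 / 60 ≤ rF c :=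
  (log_ge hc).trans (rF_ge_log (by linarith))

lemma rF_le_sF {c : ℝ} (hc : 51 / 50 ≤ c) : rF c ≤ sF c := by
  have := rF_ge hc
  rw [← sinh_rF (show 1 ≤ c by linarith)]
  exact Real.self_le_sinh_iff.2 (by linarith)

lemma gF_eq {c : ℝ} (hc : 51 / 50 ≤ c) :
    gF c = 1 / (rF c ^ 2 * sF c ^ 2) + c / (rF c * sF c ^ 3) := by
  have := rF_ge hc
  have := sF_ge hc
  have h1 : 0 < rF c := by linarith
  have h2 : 0 < sF c := by linarith
  rw [gF]; field_simp

lemma hF_eq {c : ℝ} (hc : 51 / 50 ≤ c) :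
    hF c = c / (rF c ^ 2 * sF c ^ 2) + 1 / (rF c * sF c ^ 3) := by
  have := rF_ge hc
  have := sF_ge hc
  have h1 : 0 < rF c := by linarith
  have h2 : 0 < sF c := by linarith
  rw [hF]; field_simp

lemma gF_nonneg {c : ℝ} (hc : 51 / 50 ≤ c) : 0 ≤ gF c := by
  have := rF_ge hc
  have := sF_ge hc
  have h1 : 0 < rF c := by linarith
  have h2 : 0 < sF c := by linarith
  rw [gF]; positivity

lemma hF_nonneg {c : ℝ} (hc : 51 / 50 ≤ c) : 0 ≤ hF c := by
  have := rF_ge hc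
  have := sF_ge hc
  have h1 : 0 < rF c := by linarith
  have h2 : 0 < sF c := by linarith
  rw [hF]; positivity

lemma gF_le {c : ℝ} (hc : 51 / 50 ≤ c) : gF c ≤ 10000000 / ((1 + Real.log c) * c ^ 2) := by
  have hr := rF_ge hc
  have hs := sF_ge hc
  have hl := log_ge hc
  have hrl := rF_ge_log (show 1 ≤ c by linarith)
  have hsc := sF_le (show 1 ≤ c by linarith)
  have h1 : 0 < rF c := by linarith
  have h2 : 0 < sF c := by linarith
  have hc0 : 0 < c := by linarith
  have hrl' : (1 + Real.log c) / 61 ≤ rF c := by linarith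
  have hl0 : 0 < 1 + Real.log c := by linarith
  calc gF c ≤ (c * (61 * rF c)) / (rF c ^ 2 * (c / 10) ^ 3) := by
        rw [gF]; gcongr; nlinarith
    _ = 61000 / (rF c * c ^ 2) := by field_simp; norm_num
    _ ≤ 61000 / ((1 + Real.log c) / 61 * c ^ 2) := by gcongr
    _ = 3721000 / ((1 + Real.log c) * c ^ 2) := by field_simp; norm_num
    _ ≤ _ := by gcongr; norm_num

lemma hF_le {c : ℝ} (hc : 51 / 50 ≤ c) : hF c ≤ 10000000 / ((1 + Real.log c) ^ 2 * c) := by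
  have hr := rF_ge hc
  have hs := sF_ge hc
  have hl := log_ge hc
  have hrl := rF_ge_log (show 1 ≤ c by linarith)
  have hsc := sF_le (show 1 ≤ c by linarith)
  have hrs := rF_le_sF hc
  have h1 : 0 < rF c := by linarith
  have h2 : 0 < sF c := by linarith
  have hc0 : 0 < c := by linarith
  have hrl' : (1 + Real.log c) / 61 ≤ rF c := by linarith
  have hl0 : 0 < 1 + Real.log c := by linarith
  calc hF c ≤ (2 * c ^ 2) / (rF c ^ 2 * (c / 10) ^ 3) := by
        rw [hF]; gcongr; nlinarith
    _ = 2000 / (rF c ^ 2 * c) := by field_simp; norm_num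
    _ ≤ 2000 / (((1 + Real.log c) / 61) ^ 2 * c) := by gcongr
    _ = 7442000 / ((1 + Real.log c) ^ 2 * c) := by field_simp; norm_num
    _ ≤ _ := by gcongr; norm_num

lemma rel_aux {c c' ε : ℝ} (hc : 51 / 50 ≤ c) (hcc : c ≤ c') (he : c' - c ≤ ε * c) :
    sF c ≤ sF c' ∧ rF c ≤ rF c' ∧ (1 - 700 * ε) * sF c' ≤ sF c ∧
      (1 - 700 * ε) * rF c' ≤ rF c := by
  have hc0 : 0 < c := by linarith
  have hε : 0 ≤ ε := by
    by_contra h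
    push Not at h
    nlinarith
  have hs := sF_ge hc
  have hs' := sF_ge (hc.trans hcc)
  have hr' := rF_ge (hc.trans hcc)
  have q := sF_sq (show 1 ≤ c by linarith)
  have q' := sF_sq (show 1 ≤ c' by linarith)
  have h1 : sF c ≤ sF c' := Real.sqrt_le_sqrt (by nlinarith)
  have h2 : sF c' - sF c ≤ 10 * (c' - c) := by
    have e : (sF c' - sF c) * (sF c' + sF c) = (c' - c) * (c' + c) := by nlinarith
    have e2 : (sF c' - sF c) * ((c' + c) / 10) ≤ (sF c' - sF c) * (sF c' + sF c) := by
      apply mul_le_mul_of_nonneg_left <;> linarith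
    have e3 : 0 < c' + c := by linarith
    have : (sF c' - sF c - 10 * (c' - c)) * (c' + c) ≤ 0 := by nlinarith
    by_contra h
    push Not at h
    nlinarith
  refine ⟨h1, Real.log_le_log (by linarith) (by linarith), ?_, ?_⟩
  · have : ε * c ≤ ε * (10 * sF c') := by gcongr; linarith
    nlinarith [mul_nonneg hε (sF_nonneg c')]
  · have e1 : rF c' - rF c ≤ 11 * ε := by
      rw [rF, rF, ← Real.log_div (by linarith) (by linarith)]
      have hp : 0 < c + sF c := by linarith
      have := Real.log_le_sub_one_of_pos (show 0 < (c' + sF c') / (c + sF c) by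
        apply div_pos <;> linarith)
      refine this.trans ?_
      rw [div_sub_one hp.ne', div_le_iff₀ hp]
      nlinarith [mul_nonneg hε (sF_nonneg c)]
    nlinarith

lemma gF_rel {c c' ε : ℝ} (hc : 51 / 50 ≤ c) (hcc : c ≤ c') (he : c' - c ≤ ε * c) :
    gF c' ≤ gF c ∧ gF c - gF c' ≤ 2800 * ε * gF c := by
  obtain ⟨h1, h2, h3, h4⟩ := rel_aux hc hcc he
  have hr := rF_ge hc
  have hs := sF_ge hc
  have hr0 : 0 < rF c := by linarith
  have hs0 : 0 < sF c := by linarith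
  have hr0' : 0 < rF c' := by linarith
  have hs0' : 0 < sF c' := by linarith
  have hc0 : 0 < c := by linarith
  have hc0' : 0 < c' := by linarith
  have hg := gF_nonneg hc
  have hg' := gF_nonneg (hc.trans hcc)
  constructor
  · rw [gF_eq hc, gF_eq (hc.trans hcc)]
    have e : c' / sF c' ≤ c / sF c := by
      rw [div_le_div_iff₀ hs0' hs0]
      apply le_of_sq_le_sq _ (by positivity)
      rw [mul_pow, mul_pow, sF_sq (by linarith), sF_sq (by linarith)]
      nlinarith
    have e1 : c' / (rF c' * sF c' ^ 3) = c' / sF c' * (1 / (rF c' * sF c' ^ 2)) := by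
      field_simp
    have e2 : c / (rF c * sF c ^ 3) = c / sF c * (1 / (rF c * sF c ^ 2)) := by
      field_simp
    rw [e1, e2]
    gcongr
  · set α := 700 * ε with hα
    rcases le_total 1 α with h | h
    · nlinarith
    · have key : (1 - α) ^ 4 * gF c ≤ gF c' := by
        have hb : 0 ≤ 1 - α := by linarith
        have hb1 : 1 - α ≤ 1 := by
          have : 0 ≤ ε := by
            by_contra h
            push Not at h
            nlinarith
          linarith
        rw [gF_eq hc, gF_eq (hc.trans hcc), mul_add]
        have e1 : (1 - α) ^ 4 * (1 / (rF c ^ 2 * sF c ^ 2)) ≤ 1 / (rF c' ^ 2 * sF c' ^ 2) := by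
          rw [← mul_div_assoc, mul_one, div_le_div_iff₀ (by positivity) (by positivity)]
          calc (1 - α) ^ 4 * (rF c' ^ 2 * sF c' ^ 2)
              = ((1 - α) * rF c') ^ 2 * ((1 - α) * sF c') ^ 2 := by ring
            _ ≤ 1 * (rF c ^ 2 * sF c ^ 2) := by rw [one_mul]; gcongr
        have e2 : (1 - α) ^ 4 * (c / (rF c * sF c ^ 3)) ≤ c' / (rF c' * sF c' ^ 3) := by
          rw [← mul_div_assoc, div_le_div_iff₀ (by positivity) (by positivity)]
          calc (1 - α) ^ 4 * c * (rF c' * sF c' ^ 3)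
              = c * (((1 - α) * rF c') * ((1 - α) * sF c') ^ 3) := by ring
            _ ≤ c' * (rF c * sF c ^ 3) := by gcongr
        linarith
      have bern : 1 - 4 * α ≤ (1 - α) ^ 4 := by
        have := one_add_mul_le_pow (show (-2 : ℝ) ≤ -α by linarith) 4
        norm_num at this
        rw [sub_eq_add_neg 1 α]
        linarith
      nlinarith

lemma hF_rel {c c' ε : ℝ} (hc : 51 / 50 ≤ c) (hcc : c ≤ c') (he : c' - c ≤ ε * c) :
    hF c' ≤ hF c ∧ hF c - hF c' ≤ 2800 * ε * hF c := by
  obtain ⟨h1, h2, h3, h4⟩ := rel_aux hc hcc he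
  have hr := rF_ge hc
  have hs := sF_ge hc
  have hr0 : 0 < rF c := by linarith
  have hs0 : 0 < sF c := by linarith
  have hr0' : 0 < rF c' := by linarith
  have hs0' : 0 < sF c' := by linarith
  have hc0 : 0 < c := by linarith
  have hc0' : 0 < c' := by linarith
  have hg := hF_nonneg hc
  have hg' := hF_nonneg (hc.trans hcc)
  constructor
  · rw [hF_eq hc, hF_eq (hc.trans hcc)]
    have e : c' / sF c' ≤ c / sF c := by
      rw [div_le_div_iff₀ hs0' hs0]
      apply le_of_sq_le_sq _ (by positivity)
      rw [mul_pow, mul_pow, sF_sq (by linarith), sF_sq (by linarith)]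
      nlinarith
    have e1 : c' / (rF c' ^ 2 * sF c' ^ 2) = c' / sF c' * (1 / (rF c' ^ 2 * sF c')) := by
      field_simp
    have e2 : c / (rF c ^ 2 * sF c ^ 2) = c / sF c * (1 / (rF c ^ 2 * sF c)) := by
      field_simp
    rw [e1, e2]
    gcongr
  · set α := 700 * ε with hα
    rcases le_total 1 α with h | h
    · nlinarith
    · have key : (1 - α) ^ 4 * hF c ≤ hF c' := by
        have hb : 0 ≤ 1 - α := by linarith
        rw [hF_eq hc, hF_eq (hc.trans hcc), mul_add]
        have e1 : (1 - α) ^ 4 * (c / (rF c ^ 2 * sF c ^ 2)) ≤ c' / (rF c' ^ 2 * sF c' ^ 2) := by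
          rw [← mul_div_assoc, div_le_div_iff₀ (by positivity) (by positivity)]
          calc (1 - α) ^ 4 * c * (rF c' ^ 2 * sF c' ^ 2)
              = c * (((1 - α) * rF c') ^ 2 * ((1 - α) * sF c') ^ 2) := by ring
            _ ≤ c' * (rF c ^ 2 * sF c ^ 2) := by gcongr
        have e2 : (1 - α) ^ 4 * (1 / (rF c * sF c ^ 3)) ≤ 1 / (rF c' * sF c' ^ 3) := by
          rw [← mul_div_assoc, mul_one, div_le_div_iff₀ (by positivity) (by positivity)]
          calc (1 - α) ^ 4 * (rF c' * sF c' ^ 3)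
              = ((1 - α) * rF c') * ((1 - α) * sF c') ^ 3 := by ring
            _ ≤ 1 * (rF c * sF c ^ 3) := by rw [one_mul]; gcongr
        linarith
      have bern : 1 - 4 * α ≤ (1 - α) ^ 4 := by
        have := one_add_mul_le_pow (show (-2 : ℝ) ≤ -α by linarith) 4
        norm_num at this
        rw [sub_eq_add_neg 1 α]
        linarith
      nlinarith

lemma gF_diff {c c' ε B : ℝ} (hc : 51 / 50 ≤ c) (hc' : 51 / 50 ≤ c')
    (he : |c' - c| ≤ ε * c) (he' : |c' - c| ≤ ε * c') (hε : 0 ≤ ε)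
    (hB : gF c ≤ B) (hB' : gF c' ≤ B) : |gF c - gF c'| ≤ 2800 * ε * B := by
  rcases le_total c c' with h | h
  · obtain ⟨h1, h2⟩ := gF_rel hc h ((le_abs_self _).trans he)
    rw [abs_of_nonneg (by linarith)]
    exact h2.trans (by gcongr)
  · rw [abs_sub_comm] at he'
    obtain ⟨h1, h2⟩ := gF_rel hc' h ((le_abs_self _).trans he')
    rw [abs_sub_comm, abs_of_nonneg (by linarith)]
    exact h2.trans (by gcongr)

lemma hF_diff {c c' ε B : ℝ} (hc : 51 / 50 ≤ c) (hc' : 51 / 50 ≤ c')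
    (he : |c' - c| ≤ ε * c) (he' : |c' - c| ≤ ε * c') (hε : 0 ≤ ε)
    (hB : hF c ≤ B) (hB' : hF c' ≤ B) : |hF c - hF c'| ≤ 2800 * ε * B := by
  rcases le_total c c' with h | h
  · obtain ⟨h1, h2⟩ := hF_rel hc h ((le_abs_self _).trans he)
    rw [abs_of_nonneg (by linarith)]
    exact h2.trans (by gcongr)
  · rw [abs_sub_comm] at he'
    obtain ⟨h1, h2⟩ := hF_rel hc' h ((le_abs_self _).trans he')
    rw [abs_sub_comm, abs_of_nonneg (by linarith)]
    exact h2.trans (by gcongr)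

/-- `1 + a² + |x|²`. -/
def TT (x : ℝ × ℝ × ℝ) : ℝ := 1 + x.2.2 ^ 2 + x.1 ^ 2 + x.2.1 ^ 2
def ell (x : ℝ × ℝ × ℝ) : ℝ := 1 + Real.log (TT x / x.2.2)
/-- the majorant (w.r.t. Lebesgue measure). -/
def Psi (x : ℝ × ℝ × ℝ) : ℝ :=
  1 / (TT x * Real.sqrt (TT x) * ell x) + 1 / (x.2.2 * TT x * ell x ^ 2)

/-- translation in the first coordinate. -/
def sh (L : ℝ) (x : ℝ × ℝ × ℝ) : ℝ × ℝ × ℝ := (x.1 - L, x.2)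

def cc (y x : ℝ × ℝ × ℝ) : ℝ := chD (ginvMul y x)

lemma P0_bd {y : ℝ × ℝ × ℝ} (hy : y ∈ P0) :
    |y.1| ≤ 1 ∧ |y.2.1| ≤ 1 ∧ 1 / 3 ≤ y.2.2 ∧ y.2.2 ≤ 2719 / 1000 := by
  obtain ⟨h1, h2, h3, h4⟩ := hy
  have e1 := Real.exp_one_lt_d9
  have e2 := Real.exp_neg_one_gt_d9
  exact ⟨abs_le.2 h1, abs_le.2 h2, by linarith, by linarith⟩

lemma cc_eq {y x : ℝ × ℝ × ℝ} (hb : 0 < y.2.2) (ha : 0 < x.2.2) :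
    cc y x = (x.2.2 ^ 2 + y.2.2 ^ 2 + (x.1 - y.1) ^ 2 + (x.2.1 - y.2.1) ^ 2) /
      (2 * x.2.2 * y.2.2) := by
  simp only [cc, chD, ginvMul]
  field_simp
  ring

lemma cc_ge {y x : ℝ × ℝ × ℝ} (hy : y ∈ P0) (ha : 0 < x.2.2) (hx : x ∉ twoP0) :
    51 / 50 ≤ cc y x := by
  obtain ⟨h1, h2, h3, h4⟩ := P0_bd hy
  have hb : 0 < y.2.2 := by linarith
  obtain ⟨y1, y2, b⟩ := y
  obtain ⟨x1, x2, a⟩ := x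
  rw [cc_eq hb ha, le_div_iff₀ (by positivity)]
  simp only at *
  rw [abs_le] at h1 h2
  have key : ∀ d : ℝ, 1 ≤ d ^ 2 → 51 / 50 * (2 * a * b) ≤ a ^ 2 + b ^ 2 + d ^ 2 := by
    intro d hd
    nlinarith [sq_nonneg (a - 51 / 50 * b)]
  by_cases g1 : x1 ∈ Icc (-2 : ℝ) 2
  · by_cases g2 : x2 ∈ Icc (-2 : ℝ) 2
    · have g3 : a ∉ Icc (Real.exp (-2)) (Real.exp 2) := fun h => hx ⟨g1, g2, h⟩
      obtain ⟨-, -, m1, m2⟩ := hy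
      simp only at m1 m2
      have e1 := Real.exp_one_gt_d9
      have q : 27 / 10 * b ≤ a ∨ 27 / 10 * a ≤ b := by
        rw [mem_Icc, not_and_or, not_le, not_le] at g3
        rcases g3 with g3 | g3
        · right
          have : Real.exp (-1) = Real.exp 1 * Real.exp (-2) := by
            rw [← Real.exp_add]; norm_num
          nlinarith [Real.exp_pos (-2)]
        · left
          have : Real.exp 2 = Real.exp 1 * Real.exp 1 := by
            rw [← Real.exp_add]; norm_num
          nlinarith [Real.exp_pos 1]
      rcases q with q | q
      · nlinarith [sq_nonneg (x1 - y1), sq_nonneg (x2 - y2), mul_nonneg (sub_nonneg.2 q) hb.le]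
      · nlinarith [sq_nonneg (x1 - y1), sq_nonneg (x2 - y2), mul_nonneg (sub_nonneg.2 q) ha.le]
    · have : 1 ≤ (x2 - y2) ^ 2 := by
        rw [mem_Icc, not_and_or, not_le, not_le] at g2
        rcases g2 with g | g <;> nlinarith
      nlinarith [key _ this, sq_nonneg (x1 - y1)]
  · have : 1 ≤ (x1 - y1) ^ 2 := by
      rw [mem_Icc, not_and_or, not_le, not_le] at g1
      rcases g1 with g | g <;> nlinarith
    nlinarith [key _ this, sq_nonneg (x2 - y2)]

lemma one_le_TT (x : ℝ × ℝ × ℝ) : 1 ≤ TT x := by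
  rw [TT]; nlinarith [sq_nonneg x.2.2, sq_nonneg x.1, sq_nonneg x.2.1]

lemma le_sqrt_TT (x : ℝ × ℝ × ℝ) :
    x.2.2 ≤ Real.sqrt (TT x) ∧ |x.1| ≤ Real.sqrt (TT x) ∧ |x.2.1| ≤ Real.sqrt (TT x) ∧
      1 ≤ Real.sqrt (TT x) := by
  refine ⟨?_, ?_, ?_, ?_⟩
  · apply Real.le_sqrt_of_sq_le; rw [TT]; nlinarith [sq_nonneg x.1, sq_nonneg x.2.1]
  · apply Real.le_sqrt_of_sq_le; rw [TT, sq_abs]; nlinarith [sq_nonneg x.2.2, sq_nonneg x.2.1]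
  · apply Real.le_sqrt_of_sq_le; rw [TT, sq_abs]; nlinarith [sq_nonneg x.2.2, sq_nonneg x.1]
  · apply Real.le_sqrt_of_sq_le; rw [one_pow]; exact one_le_TT x

lemma sqrt_le_TT_div {x : ℝ × ℝ × ℝ} (ha : 0 < x.2.2) : Real.sqrt (TT x) ≤ TT x / x.2.2 := by
  rw [le_div_iff₀ ha]
  have h := Real.mul_self_sqrt (zero_le_one.trans (one_le_TT x))
  have := (le_sqrt_TT x).1
  nlinarith [Real.sqrt_nonneg (TT x)]

lemma one_le_ell {x : ℝ × ℝ × ℝ} (ha : 0 < x.2.2) : 1 ≤ ell x := by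
  have := Real.log_nonneg ((le_sqrt_TT x).2.2.2.trans (sqrt_le_TT_div ha))
  rw [ell]; linarith

lemma cc_ge_TT {y x : ℝ × ℝ × ℝ} (hy : y ∈ P0) (ha : 0 < x.2.2) :
    TT x / (270 * x.2.2) ≤ cc y x := by
  obtain ⟨h1, h2, h3, h4⟩ := P0_bd hy
  have hb : 0 < y.2.2 := by linarith
  rw [cc_eq hb ha, div_le_div_iff₀ (by positivity) (by positivity)]
  obtain ⟨y1, y2, b⟩ := y
  obtain ⟨x1, x2, a⟩ := x
  simp only [TT] at *
  rw [abs_le] at h1 h2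
  have f1 : x1 ^ 2 ≤ 2 * (x1 - y1) ^ 2 + 2 := by nlinarith [sq_nonneg (x1 - 2 * y1)]
  have f2 : x2 ^ 2 ≤ 2 * (x2 - y2) ^ 2 + 2 := by nlinarith [sq_nonneg (x2 - 2 * y2)]
  have f3 : 1 + a ^ 2 + x1 ^ 2 + x2 ^ 2 ≤
      45 * (a ^ 2 + b ^ 2 + (x1 - y1) ^ 2 + (x2 - y2) ^ 2) := by nlinarith [sq_nonneg (x1 - y1), sq_nonneg (x2 - y2)]
  calc (1 + a ^ 2 + x1 ^ 2 + x2 ^ 2) * (2 * a * b)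
      ≤ (45 * (a ^ 2 + b ^ 2 + (x1 - y1) ^ 2 + (x2 - y2) ^ 2)) * (2 * a * 3) := by
        gcongr; linarith
    _ = _ := by ring

/-- generic bound from a lower bound on `c`. -/
lemma gh_bound {c : ℝ} {x : ℝ × ℝ × ℝ} (ha : 0 < x.2.2) (hc : 51 / 50 ≤ c)
    (h : TT x / (1080 * x.2.2) ≤ c) :
    gF c ≤ 10 ^ 15 * (x.2.2 ^ 2 / (TT x ^ 2 * ell x)) ∧
      hF c ≤ 10 ^ 15 * (x.2.2 / (TT x * ell x ^ 2)) := by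
  have hT := one_le_TT x
  have hl := one_le_ell ha
  have hlc := log_ge hc
  have hell : ell x / 8 ≤ 1 + Real.log c := by
    have : Real.log (TT x / (1080 * x.2.2)) ≤ Real.log c := Real.log_le_log (by positivity) h
    have e : TT x / (1080 * x.2.2) = (TT x / x.2.2) / 1080 := by field_simp
    rw [e, Real.log_div (by positivity) (by norm_num)] at this
    have l1080 : Real.log 1080 ≤ 7 := by
      rw [Real.log_le_iff_le_exp (by norm_num)]
      have : Real.exp 7 = Real.exp 1 ^ 7 := by rw [← Real.exp_nat_mul]; norm_num
      rw [this]
      calc (1080 : ℝ) ≤ 2.715 ^ 7 := by norm_num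
        _ ≤ _ := by gcongr; linarith [Real.exp_one_gt_d9]
    rw [ell]; linarith
  constructor
  · calc gF c ≤ 10000000 / ((1 + Real.log c) * c ^ 2) := gF_le hc
      _ ≤ 10000000 / ((ell x / 8) * (TT x / (1080 * x.2.2)) ^ 2) := by gcongr
      _ = (10000000 * 8 * 1080 ^ 2) * (x.2.2 ^ 2 / (TT x ^ 2 * ell x)) := by field_simp
      _ ≤ _ := by gcongr; norm_num
  · calc hF c ≤ 10000000 / ((1 + Real.log c) ^ 2 * c) := hF_le hc
      _ ≤ 10000000 / ((ell x / 8) ^ 2 * (TT x / (1080 * x.2.2))) := by gcongr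
      _ = (10000000 * 64 * 1080) * (x.2.2 / (TT x * ell x ^ 2)) := by field_simp; norm_num
      _ ≤ _ := by gcongr; norm_num

/-- explicit form of the kernels. -/
lemma kk_eq {y x : ℝ × ℝ × ℝ} (hb : 0 < y.2.2) (ha : 0 < x.2.2) (hc : 1 ≤ cc y x) :
    k0 (ginvMul y x) = (2 * Real.pi ^ 2)⁻¹ * (-gF (cc y x) + y.2.2 / x.2.2 * hF (cc y x)) ∧
    k1 (ginvMul y x) = -(2 * Real.pi ^ 2)⁻¹ * ((x.1 - y.1) / x.2.2 * gF (cc y x)) ∧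
    k2 (ginvMul y x) = -(2 * Real.pi ^ 2)⁻¹ * ((x.2.1 - y.2.1) / x.2.2 * gF (cc y x)) := by
  have hr : rD (ginvMul y x) = rF (cc y x) := rfl
  have e3 : (ginvMul y x).2.2 = x.2.2 / y.2.2 := rfl
  have e1 : (ginvMul y x).1 = (y.2.2)⁻¹ * (x.1 - y.1) := rfl
  have e2 : (ginvMul y x).2.1 = (y.2.2)⁻¹ * (x.2.1 - y.2.1) := rfl
  refine ⟨?_, ?_, ?_⟩
  · rw [k0, hr, sinh_rF hc, cosh_rF hc, e3, gF, hF, inv_div]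
    ring
  · rw [k1, hr, sinh_rF hc, cosh_rF hc, e3, e1, gF, inv_div]
    have : y.2.2 / x.2.2 * ((y.2.2)⁻¹ * (x.1 - y.1)) = (x.1 - y.1) / x.2.2 := by field_simp
    rw [← this]; ring
  · rw [k2, hr, sinh_rF hc, cosh_rF hc, e3, e2, gF, inv_div]
    have : y.2.2 / x.2.2 * ((y.2.2)⁻¹ * (x.2.1 - y.2.1)) = (x.2.1 - y.2.1) / x.2.2 := by field_simp
    rw [← this]; ring

lemma pi_const : 0 ≤ (2 * Real.pi ^ 2)⁻¹ ∧ (2 * Real.pi ^ 2)⁻¹ ≤ 1 := by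
  refine ⟨by positivity, inv_le_one_of_one_le₀ ?_⟩
  nlinarith [Real.pi_gt_three]

lemma Psi_nonneg {x : ℝ × ℝ × ℝ} (ha : 0 < x.2.2) : 0 ≤ Psi x := by
  have hT := one_le_TT x
  have hl := one_le_ell ha
  rw [Psi]; positivity

/-- pieces of the majorant. -/
lemma aPsi_ge {x : ℝ × ℝ × ℝ} (ha : 0 < x.2.2) :
    Real.sqrt (TT x) / x.2.2 * (x.2.2 ^ 2 / (TT x ^ 2 * ell x)) ≤ x.2.2 * Psi x ∧
    x.2.2 ^ 2 / (TT x ^ 2 * ell x) + 1 / x.2.2 * (x.2.2 / (TT x * ell x ^ 2)) ≤ x.2.2 * Psi x := by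
  have hT := one_le_TT x
  have hl := one_le_ell ha
  obtain ⟨q1, q2, q3, q4⟩ := le_sqrt_TT x
  have hs := Real.mul_self_sqrt (zero_le_one.trans (one_le_TT x))
  have e1 : x.2.2 * Psi x = Real.sqrt (TT x) / x.2.2 * (x.2.2 ^ 2 / (TT x ^ 2 * ell x))
      + 1 / x.2.2 * (x.2.2 / (TT x * ell x ^ 2)) := by
    rw [Psi]
    set t := Real.sqrt (TT x)
    rw [← hs]
    have : 0 < t := by linarith
    field_simp
  rw [e1]
  constructor
  · have : 0 ≤ 1 / x.2.2 * (x.2.2 / (TT x * ell x ^ 2)) := by positivity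
    linarith
  · gcongr
    apply le_mul_of_one_le_left (by positivity)
    rwa [one_le_div ha]

lemma kk_bound {y x : ℝ × ℝ × ℝ} (hy : y ∈ P0) (ha : 0 < x.2.2) (hx : x ∉ twoP0) (i : ℕ) :
    |kk i (ginvMul y x)| ≤ 10 ^ 16 * (x.2.2 * Psi x) := by
  obtain ⟨h1, h2, h3, h4⟩ := P0_bd hy
  have hb : 0 < y.2.2 := by linarith
  have hc := cc_ge hy ha hx
  have hT := one_le_TT x
  have hl := one_le_ell ha
  obtain ⟨q1, q2, q3, q4⟩ := le_sqrt_TT x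
  obtain ⟨p1, p2⟩ := pi_const
  obtain ⟨E0, E1, E2⟩ := kk_eq hb ha (show 1 ≤ cc y x by linarith)
  have hcT := cc_ge_TT hy ha
  obtain ⟨G, H⟩ := gh_bound (c := cc y x) ha hc (le_trans (by gcongr; norm_num) hcT)
  have g0 := gF_nonneg hc
  have h0 := hF_nonneg hc
  obtain ⟨A1, A2⟩ := aPsi_ge ha
  have dir : ∀ z w : ℝ, |z| ≤ Real.sqrt (TT x) → |w| ≤ 1 →
      |-(2 * Real.pi ^ 2)⁻¹ * ((z - w) / x.2.2 * gF (cc y x))| ≤ 10 ^ 16 * (x.2.2 * Psi x) := by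
    intro z w hz hw
    rw [abs_mul, abs_neg, abs_of_nonneg p1, abs_mul, abs_div, abs_of_pos ha, abs_of_nonneg g0]
    have : |z - w| ≤ 2 * Real.sqrt (TT x) := (abs_sub _ _).trans (by linarith)
    calc (2 * Real.pi ^ 2)⁻¹ * (|z - w| / x.2.2 * gF (cc y x))
        ≤ 1 * ((2 * Real.sqrt (TT x)) / x.2.2 * (10 ^ 15 * (x.2.2 ^ 2 / (TT x ^ 2 * ell x)))) := by
          gcongr
      _ = (2 * 10 ^ 15) * (Real.sqrt (TT x) / x.2.2 * (x.2.2 ^ 2 / (TT x ^ 2 * ell x))) := by ring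
      _ ≤ (2 * 10 ^ 15) * (x.2.2 * Psi x) := by gcongr
      _ ≤ _ := by
        have := mul_nonneg ha.le (Psi_nonneg ha)
        gcongr; norm_num
  match i with
  | 0 =>
    simp only [kk]
    rw [E0, abs_mul, abs_of_nonneg p1]
    have hh : 0 ≤ y.2.2 / x.2.2 * hF (cc y x) := by positivity
    calc (2 * Real.pi ^ 2)⁻¹ * |-gF (cc y x) + y.2.2 / x.2.2 * hF (cc y x)|
        ≤ 1 * (gF (cc y x) + y.2.2 / x.2.2 * hF (cc y x)) := by
          gcongr
          refine (abs_add_le _ _).trans ?_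
          rw [abs_neg, abs_of_nonneg g0, abs_of_nonneg hh]
      _ ≤ 1 * (3 * (10 ^ 15 * (x.2.2 ^ 2 / (TT x ^ 2 * ell x)))
            + 3 / x.2.2 * (10 ^ 15 * (x.2.2 / (TT x * ell x ^ 2)))) := by
          gcongr
          · linarith
          · linarith
      _ = (3 * 10 ^ 15) * (x.2.2 ^ 2 / (TT x ^ 2 * ell x) +
            1 / x.2.2 * (x.2.2 / (TT x * ell x ^ 2))) := by ring
      _ ≤ (3 * 10 ^ 15) * (x.2.2 * Psi x) := by gcongr
      _ ≤ _ := by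
        have := mul_nonneg ha.le (Psi_nonneg ha)
        gcongr; norm_num
  | 1 => simp only [kk]; rw [E1]; exact dir _ _ q2 h1
  | (n + 2) => simp only [kk]; rw [E2]; exact dir _ _ q3 h2

lemma not_twoP0_of {x : ℝ × ℝ × ℝ} (h : 2 < |x.1|) : x ∉ twoP0 := fun hx => by
  have := abs_le.2 hx.1
  linarith

lemma TT_sh {x : ℝ × ℝ × ℝ} {L : ℝ} (hx : 2 * L < |x.1|) (hL : 0 < L) :
    TT x / 4 ≤ TT (sh L x) ∧ |x.1| / 2 ≤ |x.1 - L| := by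
  have h : |x.1| / 2 ≤ |x.1 - L| := by
    have := abs_sub_abs_le_abs_sub x.1 L
    rw [abs_of_pos hL] at this
    linarith
  refine ⟨?_, h⟩
  have h2 : (|x.1| / 2) ^ 2 ≤ |x.1 - L| ^ 2 := by gcongr
  rw [sq_abs, div_pow, sq_abs] at h2
  simp only [TT, sh]
  nlinarith [sq_nonneg x.2.2, sq_nonneg x.2.1]

lemma kk_diff {y x : ℝ × ℝ × ℝ} {L : ℝ} (hL : 2 < L) (hy : y ∈ P0) (ha : 0 < x.2.2)
    (hx : 2 * L < |x.1|) (i : ℕ) :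
    |kk i (ginvMul y (sh L x)) - kk i (ginvMul y x)| ≤ 10 ^ 25 * (L / |x.1|) * (x.2.2 * Psi x) := by
  obtain ⟨h1, h2, h3, h4⟩ := P0_bd hy
  have hb : 0 < y.2.2 := by linarith
  obtain ⟨t1, t2⟩ := TT_sh hx (by linarith)
  have ha' : 0 < (sh L x).2.2 := ha
  have hc := cc_ge hy ha (not_twoP0_of (by linarith))
  have hc' := cc_ge (x := sh L x) hy ha (not_twoP0_of (show 2 < |x.1 - L| by linarith))
  have hT := one_le_TT x
  have hl := one_le_ell ha
  obtain ⟨q1, q2, q3, q4⟩ := le_sqrt_TT x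
  have hs := Real.mul_self_sqrt (zero_le_one.trans (one_le_TT x))
  obtain ⟨p1, p2⟩ := pi_const
  obtain ⟨E0, E1, E2⟩ := kk_eq hb ha (show 1 ≤ cc y x by linarith)
  obtain ⟨E0', E1', E2'⟩ := kk_eq hb ha' (show 1 ≤ cc y (sh L x) by linarith)
  have hcT : TT x / (1080 * x.2.2) ≤ cc y x :=
    le_trans (by gcongr; norm_num) (cc_ge_TT hy ha)
  have hcT' : TT x / (1080 * x.2.2) ≤ cc y (sh L x) := by
    refine le_trans ?_ (cc_ge_TT hy ha')
    calc TT x / (1080 * x.2.2) = (TT x / 4) / (270 * x.2.2) := by field_simp; norm_num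
      _ ≤ _ := by
        show _ ≤ TT (sh L x) / (270 * x.2.2)
        gcongr
  obtain ⟨G, H⟩ := gh_bound (c := cc y x) ha hc hcT
  obtain ⟨G', H'⟩ := gh_bound (c := cc y (sh L x)) ha hc' hcT'
  have g0 := gF_nonneg hc
  have h0 := hF_nonneg hc
  have g0' := gF_nonneg hc'
  obtain ⟨A1, A2⟩ := aPsi_ge ha
  set t := Real.sqrt (TT x) with ht
  have ht0 : 0 < t := by linarith
  have hx0 : 0 < |x.1| := by linarith
  -- difference of the `c`s
  set ε := 8100 * (L / t) with hε
  have hε0 : 0 ≤ ε := by positivity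
  have hdc : |cc y (sh L x) - cc y x| ≤ ε * (TT x / (1080 * x.2.2)) := by
    have e : cc y (sh L x) - cc y x = L * (L - 2 * (x.1 - y.1)) / (2 * x.2.2 * y.2.2) := by
      rw [cc_eq hb ha, cc_eq hb ha']
      simp only [sh]
      field_simp
      ring
    have e2 : |L - 2 * (x.1 - y.1)| ≤ 5 * t := by
      have : L ≤ t := by linarith
      rw [abs_le] at h1 q2 ⊢
      constructor <;> linarith
    rw [e, abs_div, abs_mul, abs_of_pos (show 0 < L by linarith),
      abs_of_pos (show 0 < 2 * x.2.2 * y.2.2 by positivity)]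
    calc L * |L - 2 * (x.1 - y.1)| / (2 * x.2.2 * y.2.2)
        ≤ L * (5 * t) / (2 * x.2.2 * (1 / 3)) := by gcongr
      _ = ε * (TT x / (1080 * x.2.2)) := by
        rw [hε, ← hs]; field_simp; norm_num
  have hd1 : |cc y (sh L x) - cc y x| ≤ ε * cc y x := hdc.trans (by gcongr)
  have hd2 : |cc y (sh L x) - cc y x| ≤ ε * cc y (sh L x) := hdc.trans (by gcongr)
  have DG := gF_diff hc hc' hd1 hd2 hε0 G G'
  have DH := hF_diff hc hc' hd1 hd2 hε0 H H'
  have hLt : L / t ≤ L / |x.1| := by gcongr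
  have Pn := mul_nonneg ha.le (Psi_nonneg ha)
  have fin : ∀ z : ℝ, z ≤ 10 ^ 25 * (L / t) * (x.2.2 * Psi x) →
      z ≤ 10 ^ 25 * (L / |x.1|) * (x.2.2 * Psi x) := fun z hz => hz.trans (by gcongr)
  apply fin
  have dir : ∀ z w z' : ℝ, |z| ≤ t → |w| ≤ 1 → |z' - z| ≤ L →
      |-(2 * Real.pi ^ 2)⁻¹ * ((z' - w) / x.2.2 * gF (cc y (sh L x)))
        - -(2 * Real.pi ^ 2)⁻¹ * ((z - w) / x.2.2 * gF (cc y x))|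
        ≤ 10 ^ 25 * (L / t) * (x.2.2 * Psi x) := by
    intro z w z' hz hw hzz
    have e : -(2 * Real.pi ^ 2)⁻¹ * ((z' - w) / x.2.2 * gF (cc y (sh L x)))
        - -(2 * Real.pi ^ 2)⁻¹ * ((z - w) / x.2.2 * gF (cc y x))
        = (2 * Real.pi ^ 2)⁻¹ * ((z - w) / x.2.2 * (gF (cc y x) - gF (cc y (sh L x)))
          - (z' - z) / x.2.2 * gF (cc y (sh L x))) := by ring
    rw [e, abs_mul, abs_of_nonneg p1]
    have hzw : |z - w| ≤ 2 * t := (abs_sub _ _).trans (by linarith)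
    calc (2 * Real.pi ^ 2)⁻¹ * |(z - w) / x.2.2 * (gF (cc y x) - gF (cc y (sh L x)))
          - (z' - z) / x.2.2 * gF (cc y (sh L x))|
        ≤ 1 * (|z - w| / x.2.2 * |gF (cc y x) - gF (cc y (sh L x))|
          + |z' - z| / x.2.2 * gF (cc y (sh L x))) := by
          gcongr
          refine (abs_sub _ _).trans ?_
          rw [abs_mul, abs_mul, abs_div, abs_div, abs_of_pos ha, abs_of_nonneg g0']
      _ ≤ 1 * ((2 * t) / x.2.2 * (2800 * ε * (10 ^ 15 * (x.2.2 ^ 2 / (TT x ^ 2 * ell x))))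
          + L / x.2.2 * (10 ^ 15 * (x.2.2 ^ 2 / (TT x ^ 2 * ell x)))) := by gcongr
      _ = ((2 * 2800 * 8100 + 1) * 10 ^ 15) * (L / t) *
            (t / x.2.2 * (x.2.2 ^ 2 / (TT x ^ 2 * ell x))) := by
          rw [hε]; field_simp
      _ ≤ ((2 * 2800 * 8100 + 1) * 10 ^ 15) * (L / t) * (x.2.2 * Psi x) := by gcongr
      _ ≤ _ := by gcongr; norm_num
  match i with
  | 0 =>
    simp only [kk]
    rw [E0, E0', ← mul_sub, abs_mul, abs_of_nonneg p1]
    have e : (-gF (cc y (sh L x)) + y.2.2 / (sh L x).2.2 * hF (cc y (sh L x)) -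
        (-gF (cc y x) + y.2.2 / x.2.2 * hF (cc y x))) =
        (gF (cc y x) - gF (cc y (sh L x))) - y.2.2 / x.2.2 * (hF (cc y x) - hF (cc y (sh L x))) := by
      simp only [sh]; ring
    rw [e]
    calc (2 * Real.pi ^ 2)⁻¹ * |(gF (cc y x) - gF (cc y (sh L x))) -
            y.2.2 / x.2.2 * (hF (cc y x) - hF (cc y (sh L x)))|
        ≤ 1 * (|gF (cc y x) - gF (cc y (sh L x))| +
            y.2.2 / x.2.2 * |hF (cc y x) - hF (cc y (sh L x))|) := by
          gcongr
          refine (abs_sub _ _).trans ?_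
          rw [abs_mul, abs_of_pos (show 0 < y.2.2 / x.2.2 by positivity)]
      _ ≤ 1 * (3 * (2800 * ε * (10 ^ 15 * (x.2.2 ^ 2 / (TT x ^ 2 * ell x))))
            + 3 / x.2.2 * (2800 * ε * (10 ^ 15 * (x.2.2 / (TT x * ell x ^ 2))))) := by
          have : 0 ≤ |gF (cc y x) - gF (cc y (sh L x))| := abs_nonneg _
          gcongr
          · linarith
          · linarith
      _ = (3 * 2800 * 8100 * 10 ^ 15) * (L / t) * (x.2.2 ^ 2 / (TT x ^ 2 * ell x) +
            1 / x.2.2 * (x.2.2 / (TT x * ell x ^ 2))) := by rw [hε]; ring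
      _ ≤ (3 * 2800 * 8100 * 10 ^ 15) * (L / t) * (x.2.2 * Psi x) := by gcongr
      _ ≤ _ := by gcongr; norm_num
  | 1 =>
    simp only [kk]; rw [E1, E1']
    refine dir x.1 y.1 (x.1 - L) q2 h1 ?_
    rw [abs_le]; constructor <;> linarith
  | (n + 2) =>
    simp only [kk]; rw [E2, E2']
    refine dir x.2.1 y.2.1 x.2.1 q3 h2 ?_
    rw [sub_self, abs_zero]; linarith

/-- The fundamental theorem of calculus as an upper bound on an exhausted set. -/
lemma ftc_le {F f : ℝ → ℝ} {s : Set ℝ} (u v : ℕ → ℝ) (hu : Antitone u) (hv : Monotone v)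
    (huv : ∀ n, u n ≤ v n)
    (hs : s ⊆ ⋃ n, Icc (u n) (v n)) (hs' : ∀ n, Icc (u n) (v n) ⊆ s)
    (hF : ∀ x ∈ s, HasDerivAt F (f x) x) (hf : ∀ x ∈ s, 0 ≤ f x) {m M : ℝ}
    (hm : ∀ x ∈ s, m ≤ F x) (hM : ∀ x ∈ s, F x ≤ M) :
    ∫⁻ x in s, ENNReal.ofReal (f x) ≤ ENNReal.ofReal (M - m) := by
  have hse : s = ⋃ n, Icc (u n) (v n) := Subset.antisymm hs (iUnion_subset hs')
  rw [hse, setLIntegral_iUnion_of_directed]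
  · apply iSup_le
    intro n
    have hsub : uIcc (u n) (v n) ⊆ s := by rw [uIcc_of_le (huv n)]; exact hs' n
    have hcont : ContinuousOn F (Icc (u n) (v n)) := fun x hx =>
      (hF x (hs' n hx)).continuousAt.continuousWithinAt
    have hint : IntegrableOn f (Ioc (u n) (v n)) := by
      apply intervalIntegral.integrableOn_deriv_of_nonneg hcont
      · intro x hx; exact hF x (hs' n (Ioo_subset_Icc_self hx))
      · intro x hx; exact hf x (hs' n (Ioo_subset_Icc_self hx))
    have hI : ∫ x in (u n)..(v n), f x = F (v n) - F (u n) := by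
      apply intervalIntegral.integral_eq_sub_of_hasDerivAt
      · intro x hx; exact hF x (hsub hx)
      · exact (intervalIntegrable_iff_integrableOn_Ioc_of_le (huv n)).2 hint
    rw [intervalIntegral.integral_of_le (huv n)] at hI
    have hre : ∫⁻ x in Icc (u n) (v n), ENNReal.ofReal (f x) =
        ∫⁻ x in Ioc (u n) (v n), ENNReal.ofReal (f x) := by
      rw [restrict_Ioc_eq_restrict_Icc]
    rw [hre, ← ofReal_integral_eq_lintegral_ofReal hint]
    · apply ENNReal.ofReal_le_ofReal
      rw [hI]
      have := hm (u n) (hs' n (left_mem_Icc.2 (huv n)))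
      have := hM (v n) (hs' n (right_mem_Icc.2 (huv n)))
      linarith
    · refine (ae_restrict_iff' measurableSet_Ioc).2 (Filter.Eventually.of_forall ?_)
      intro x hx; exact hf x (hs' n (Ioc_subset_Icc_self hx))
  · exact directed_of_isDirected_le fun i j hij => Icc_subset_Icc (hu hij) (hv hij)

lemma ftc_Ioi {F f : ℝ → ℝ} {a : ℝ}
    (hF : ∀ x ∈ Ioi a, HasDerivAt F (f x) x) (hf : ∀ x ∈ Ioi a, 0 ≤ f x) {m M : ℝ}
    (hm : ∀ x ∈ Ioi a, m ≤ F x) (hM : ∀ x ∈ Ioi a, F x ≤ M) :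
    ∫⁻ x in Ioi a, ENNReal.ofReal (f x) ≤ ENNReal.ofReal (M - m) := by
  refine ftc_le (fun n => a + 1 / ((n : ℝ) + 1)) (fun n => a + 1 + n) ?_ ?_ ?_ ?_ ?_ hF hf hm hM
  · intro i j hij; (try simp only); gcongr
  · intro i j hij; (try simp only); gcongr
  · intro n
    have : 1 / ((n : ℝ) + 1) ≤ 1 := by
      rw [div_le_one (by positivity)]; linarith [Nat.cast_nonneg (α := ℝ) n]
    (try simp only); linarith [Nat.cast_nonneg (α := ℝ) n]
  · intro x hx
    rw [mem_Ioi] at hx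
    obtain ⟨n, hn⟩ := exists_nat_one_div_lt (sub_pos.2 hx)
    obtain ⟨k, hk⟩ := exists_nat_ge (x - a - 1)
    rw [mem_iUnion]
    refine ⟨max n k, ?_, ?_⟩
    · have : 1 / (((max n k : ℕ) : ℝ) + 1) ≤ 1 / ((n : ℝ) + 1) := by
        gcongr; exact le_max_left _ _
      linarith
    · have : (k : ℝ) ≤ ((max n k : ℕ) : ℝ) := by exact_mod_cast le_max_right _ _
      linarith
  · intro n x hx
    have : 0 < 1 / ((n : ℝ) + 1) := by positivity
    rw [mem_Ioi]; linarith [hx.1]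

lemma ftc_Ioc {F f : ℝ → ℝ} {a b : ℝ} (hab : a < b)
    (hF : ∀ x ∈ Ioc a b, HasDerivAt F (f x) x) (hf : ∀ x ∈ Ioc a b, 0 ≤ f x) {m M : ℝ}
    (hm : ∀ x ∈ Ioc a b, m ≤ F x) (hM : ∀ x ∈ Ioc a b, F x ≤ M) :
    ∫⁻ x in Ioc a b, ENNReal.ofReal (f x) ≤ ENNReal.ofReal (M - m) := by
  refine ftc_le (fun n => a + (b - a) / ((n : ℝ) + 1)) (fun n => b) ?_ ?_ ?_ ?_ ?_ hF hf hm hM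
  · have : 0 < b - a := by linarith
    intro i j hij; (try simp only); gcongr
  · exact monotone_const
  · intro n
    have : (b - a) / ((n : ℝ) + 1) ≤ b - a := by
      apply div_le_self (by linarith); linarith [Nat.cast_nonneg (α := ℝ) n]
    (try simp only); linarith
  · intro x hx
    obtain ⟨n, hn⟩ := exists_nat_one_div_lt (div_pos (sub_pos.2 hx.1) (sub_pos.2 hab))
    rw [mem_iUnion]
    refine ⟨n, ?_, hx.2⟩
    rw [lt_div_iff₀ (by linarith)] at hn
    have : (b - a) / ((n : ℝ) + 1) = 1 / ((n : ℝ) + 1) * (b - a) := by ring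
    (try simp only); linarith
  · intro n x hx
    have : 0 < (b - a) / ((n : ℝ) + 1) := div_pos (by linarith) (by positivity)
    exact ⟨by linarith [hx.1], hx.2⟩

lemma ftc_univ {F f : ℝ → ℝ}
    (hF : ∀ x, HasDerivAt F (f x) x) (hf : ∀ x, 0 ≤ f x) {m M : ℝ}
    (hm : ∀ x, m ≤ F x) (hM : ∀ x, F x ≤ M) :
    ∫⁻ x, ENNReal.ofReal (f x) ≤ ENNReal.ofReal (M - m) := by
  rw [← setLIntegral_univ]
  refine ftc_le (fun n => -(n : ℝ)) (fun n => (n : ℝ)) ?_ ?_ ?_ ?_ (fun _ => subset_univ _)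
    (fun x _ => hF x) (fun x _ => hf x) (fun x _ => hm x) (fun x _ => hM x)
  · intro i j hij; (try simp only); gcongr
  · intro i j hij; (try simp only); gcongr
  · intro n; (try simp only); linarith [Nat.cast_nonneg (α := ℝ) n]
  · intro x _
    obtain ⟨k, hk⟩ := exists_nat_ge |x|
    rw [mem_iUnion]
    exact ⟨k, abs_le.1 hk⟩

/-- The `a`-integral of the majorant. -/
lemma int_a (x1 x2 : ℝ) :
    ∫⁻ a in Ioi (0 : ℝ), ENNReal.ofReal (Psi (x1, x2, a)) ≤
      ENNReal.ofReal (10 / ((1 + x1 ^ 2 + x2 ^ 2) * (1 + Real.log (1 + x1 ^ 2 + x2 ^ 2)))) := by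
  set S := 1 + x1 ^ 2 + x2 ^ 2 with hS
  have hS1 : 1 ≤ S := by nlinarith [sq_nonneg x1, sq_nonneg x2]
  have hlS : 0 ≤ Real.log S := Real.log_nonneg hS1
  have hTS : ∀ a : ℝ, TT (x1, x2, a) = S + a ^ 2 := by intro a; simp only [TT, hS]; ring
  have hell : ∀ a : ℝ, 0 < a → (1 + Real.log S) / 2 ≤ ell (x1, x2, a) := by
    intro a ha
    have h1 := sqrt_le_TT_div (x := (x1, x2, a)) ha
    have h2 : Real.sqrt S ≤ Real.sqrt (TT (x1, x2, a)) := by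
      rw [hTS]; apply Real.sqrt_le_sqrt; nlinarith
    have h3 : Real.log (Real.sqrt S) ≤ Real.log (TT (x1, x2, a) / a) :=
      Real.log_le_log (by positivity) (h2.trans h1)
    rw [Real.log_sqrt (by linarith)] at h3
    simp only [ell]; linarith
  -- first part
  have I1 : ∫⁻ a in Ioi (0 : ℝ), ENNReal.ofReal
      (1 / (TT (x1, x2, a) * Real.sqrt (TT (x1, x2, a)) * ell (x1, x2, a))) ≤
      ENNReal.ofReal (2 / (S * (1 + Real.log S))) := by
    calc _ ≤ ∫⁻ a in Ioi (0 : ℝ), ENNReal.ofReal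
          (2 / (1 + Real.log S) * (1 / ((S + a ^ 2) * Real.sqrt (S + a ^ 2)))) := by
          refine setLIntegral_mono' measurableSet_Ioi fun a ha => ENNReal.ofReal_le_ofReal ?_
          rw [hTS]
          have := hell a ha
          calc _ ≤ 1 / ((S + a ^ 2) * Real.sqrt (S + a ^ 2) * ((1 + Real.log S) / 2)) := by gcongr
            _ = _ := by field_simp
      _ ≤ ENNReal.ofReal (2 / (1 + Real.log S) * (1 / S) - 0) := by
          refine ftc_Ioi (F := fun a => 2 / (1 + Real.log S) * (a / (S * Real.sqrt (S + a ^ 2))))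
            ?_ ?_ ?_ ?_
          · intro a ha
            have hpos : 0 < S + a ^ 2 := by positivity
            have hd : HasDerivAt (fun a : ℝ => S + a ^ 2) (2 * a) a := by
              simpa using (hasDerivAt_pow 2 a).const_add S
            have hd2 := (hd.sqrt hpos.ne').const_mul S
            have hd3 := ((hasDerivAt_id a).div hd2 (by positivity)).const_mul (2 / (1 + Real.log S))
            refine hd3.congr_deriv ?_
            have hs := Real.mul_self_sqrt hpos.le
            set t := Real.sqrt (S + a ^ 2)
            have ht : 0 < t := by positivity
            simp only [id]
            rw [← hs]
            field_simp
            nlinarith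
          · intro a ha; positivity
          · intro a ha; rw [mem_Ioi] at ha; positivity
          · intro a ha
            rw [mem_Ioi] at ha
            have : a / (S * Real.sqrt (S + a ^ 2)) ≤ 1 / S := by
              rw [div_le_div_iff₀ (by positivity) (by positivity)]
              have : a ≤ Real.sqrt (S + a ^ 2) := Real.le_sqrt_of_sq_le (by linarith)
              nlinarith
            (try simp only); gcongr
      _ = _ := by congr 1; field_simp; ring
  have I2 : ∫⁻ a in Ioc (0 : ℝ) (Real.sqrt S), ENNReal.ofReal
      (1 / (a * TT (x1, x2, a) * ell (x1, x2, a) ^ 2)) ≤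
      ENNReal.ofReal (2 / (S * (1 + Real.log S))) := by
    have hsq : 0 < Real.sqrt S := by positivity
    have hlog : ∀ a ∈ Ioc 0 (Real.sqrt S), Real.log a ≤ Real.log S / 2 := by
      intro a ha
      rw [← Real.log_sqrt (by linarith)]
      exact Real.log_le_log ha.1 ha.2
    calc _ ≤ ∫⁻ a in Ioc (0 : ℝ) (Real.sqrt S), ENNReal.ofReal
          (1 / S * (a⁻¹ / (1 + Real.log S - Real.log a) ^ 2)) := by
          refine setLIntegral_mono' measurableSet_Ioc fun a ha => ENNReal.ofReal_le_ofReal ?_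
          have := hlog a ha
          have ha0 := ha.1
          have e : 1 + Real.log S - Real.log a ≤ ell (x1, x2, a) := by
            simp only [ell, hTS]
            rw [Real.log_div (by positivity) ha0.ne']
            have : Real.log S ≤ Real.log (S + a ^ 2) := Real.log_le_log (by linarith) (by nlinarith)
            linarith
          have e0 : 0 < 1 + Real.log S - Real.log a := by linarith
          calc _ ≤ 1 / (a * S * (1 + Real.log S - Real.log a) ^ 2) := by
                rw [hTS]; gcongr; nlinarith
            _ = _ := by field_simp
      _ ≤ ENNReal.ofReal (2 / (S * (1 + Real.log S)) - 0) := by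
          refine ftc_Ioc hsq (F := fun a => 1 / S * (1 + Real.log S - Real.log a)⁻¹) ?_ ?_ ?_ ?_
          · intro a ha
            have := hlog a ha
            have e0 : 0 < 1 + Real.log S - Real.log a := by linarith
            have hd := (((Real.hasDerivAt_log ha.1.ne').const_sub (1 + Real.log S)).inv e0.ne').const_mul
              (1 / S)
            refine hd.congr_deriv ?_
            rw [neg_neg]
          · intro a ha
            have := ha.1
            positivity
          · intro a ha
            have := hlog a ha
            have e0 : 0 < 1 + Real.log S - Real.log a := by linarith
            positivity
          · intro a ha
            have := hlog a ha
            have e0 : (1 + Real.log S) / 2 ≤ 1 + Real.log S - Real.log a := by linarith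
            calc 1 / S * (1 + Real.log S - Real.log a)⁻¹ ≤ 1 / S * ((1 + Real.log S) / 2)⁻¹ := by
                  gcongr
              _ = _ := by field_simp
      _ = _ := by rw [sub_zero]
  have I3 : ∫⁻ a in Ioi (Real.sqrt S), ENNReal.ofReal
      (1 / (a * TT (x1, x2, a) * ell (x1, x2, a) ^ 2)) ≤
      ENNReal.ofReal (1 / (S * (1 + Real.log S))) := by
    have hsq : 0 < Real.sqrt S := by positivity
    calc _ ≤ ∫⁻ a in Ioi (Real.sqrt S), ENNReal.ofReal (2 / (1 + Real.log S) * (1 / a ^ 3)) := by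
          refine setLIntegral_mono' measurableSet_Ioi fun a ha => ENNReal.ofReal_le_ofReal ?_
          rw [mem_Ioi] at ha
          have ha0 : 0 < a := by linarith
          have h1 := hell a ha0
          have h2 := one_le_ell (x := (x1, x2, a)) ha0
          have h3 : (1 + Real.log S) / 2 ≤ ell (x1, x2, a) ^ 2 := by nlinarith
          calc _ ≤ 1 / (a * a ^ 2 * ((1 + Real.log S) / 2)) := by
                rw [hTS]; gcongr; linarith
            _ = _ := by field_simp
      _ ≤ ENNReal.ofReal (0 - (-(1 / (S * (1 + Real.log S))))) := by
          refine ftc_Ioi (F := fun a => -(1 / (1 + Real.log S) * (a ^ 2)⁻¹)) ?_ ?_ ?_ ?_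
          · intro a ha
            rw [mem_Ioi] at ha
            have ha0 : 0 < a := by linarith
            have hd := (((hasDerivAt_pow 2 a).inv (by positivity)).const_mul (1 / (1 + Real.log S))).neg
            refine hd.congr_deriv ?_
            simp
            field_simp
          · intro a ha
            rw [mem_Ioi] at ha
            have ha0 : 0 < a := by linarith
            positivity
          · intro a ha
            rw [mem_Ioi] at ha
            have ha0 : 0 < a := by linarith
            have : S ≤ a ^ 2 := by
              have := Real.sq_sqrt (show 0 ≤ S by linarith)
              nlinarith
            try simp only
            rw [neg_le_neg_iff]
            calc 1 / (1 + Real.log S) * (a ^ 2)⁻¹ ≤ 1 / (1 + Real.log S) * S⁻¹ := by gcongr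
              _ = _ := by field_simp
          · intro a ha
            simp only [Left.neg_nonpos_iff]
            positivity
      _ = _ := by congr 1; ring
  have hp : 0 ≤ 1 / (S * (1 + Real.log S)) := by positivity
  have hm : Measurable fun a : ℝ => Psi (x1, x2, a) := by
    unfold Psi ell TT; fun_prop
  calc ∫⁻ a in Ioi (0 : ℝ), ENNReal.ofReal (Psi (x1, x2, a))
      ≤ ∫⁻ a in Ioi (0 : ℝ), (ENNReal.ofReal
          (1 / (TT (x1, x2, a) * Real.sqrt (TT (x1, x2, a)) * ell (x1, x2, a))) +
          ENNReal.ofReal (1 / (a * TT (x1, x2, a) * ell (x1, x2, a) ^ 2))) := by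
        refine lintegral_mono fun a => ?_
        exact ENNReal.ofReal_add_le
    _ = _ + ∫⁻ a in Ioi (0 : ℝ), ENNReal.ofReal (1 / (a * TT (x1, x2, a) * ell (x1, x2, a) ^ 2)) := by
        rw [lintegral_add_left]
        unfold ell TT; fun_prop
    _ ≤ ENNReal.ofReal (2 / (S * (1 + Real.log S))) + (ENNReal.ofReal (2 / (S * (1 + Real.log S)))
          + ENNReal.ofReal (1 / (S * (1 + Real.log S)))) := by
        gcongr
        rw [← Ioc_union_Ioi_eq_Ioi (Real.sqrt_nonneg S)]
        refine (lintegral_union_le _ _ _).trans ?_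
        gcongr
    _ ≤ _ := by
        rw [← ENNReal.ofReal_add (by positivity) (by positivity),
          ← ENNReal.ofReal_add (by positivity) (by positivity)]
        apply ENNReal.ofReal_le_ofReal
        have : 10 / (S * (1 + Real.log S)) = 10 * (1 / (S * (1 + Real.log S))) := by ring
        have : 2 / (S * (1 + Real.log S)) = 2 * (1 / (S * (1 + Real.log S))) := by ring
        linarith

/-- the `x₁`-marginal majorant -/
def JJ (x : ℝ) : ℝ := 320 / ((1 + |x|) * (1 + Real.log (1 + |x|)))

lemma JJ_nonneg (x : ℝ) : 0 ≤ JJ x := by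
  have : 0 ≤ Real.log (1 + |x|) := Real.log_nonneg (by linarith [abs_nonneg x])
  unfold JJ; positivity

lemma int_x2 (x1 : ℝ) :
    ∫⁻ x2, ENNReal.ofReal (10 / ((1 + x1 ^ 2 + x2 ^ 2) * (1 + Real.log (1 + x1 ^ 2 + x2 ^ 2)))) ≤
      ENNReal.ofReal (JJ x1) := by
  set Q := 1 + x1 ^ 2 with hQ
  have hQ1 : 1 ≤ Q := by nlinarith [sq_nonneg x1]
  have hlQ : 0 ≤ Real.log Q := Real.log_nonneg hQ1
  set q := Real.sqrt Q with hq
  have hq0 : 0 < q := by positivity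
  have hqq : q ^ 2 = Q := Real.sq_sqrt (by linarith)
  have hlx : 0 ≤ Real.log (1 + |x1|) := Real.log_nonneg (by linarith [abs_nonneg x1])
  have hQx : (1 + |x1|) ^ 2 / 2 ≤ Q := by
    rw [hQ, ← sq_abs x1]; nlinarith [sq_nonneg (1 - |x1|)]
  have hlog : (1 + Real.log (1 + |x1|)) / 4 ≤ 1 + Real.log Q := by
    have h := Real.log_le_log (by positivity) hQx
    rw [Real.log_div (by positivity) (by norm_num), Real.log_pow] at h
    push_cast at h
    have := Real.log_two_lt_d9
    linarith
  have hqx : (1 + |x1|) / 2 ≤ q := by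
    apply Real.le_sqrt_of_sq_le
    nlinarith [sq_nonneg (1 + |x1|)]
  calc _ ≤ ∫⁻ x2, ENNReal.ofReal (10 / (1 + Real.log Q) * (1 / (Q + x2 ^ 2))) := by
        refine lintegral_mono fun x2 => ENNReal.ofReal_le_ofReal ?_
        have : Real.log Q ≤ Real.log (Q + x2 ^ 2) :=
          Real.log_le_log (by linarith) (by nlinarith [sq_nonneg x2])
        calc _ ≤ 10 / ((Q + x2 ^ 2) * (1 + Real.log Q)) := by gcongr
          _ = _ := by field_simp
    _ ≤ ENNReal.ofReal (10 / (1 + Real.log Q) * (2 / q) - (-(10 / (1 + Real.log Q) * (2 / q)))) := by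
        refine ftc_univ (F := fun x => 10 / (1 + Real.log Q) * (Real.arctan (x / q) / q)) ?_ ?_ ?_ ?_
        · intro x
          have hd := ((((hasDerivAt_id x).div_const q).arctan).div_const q).const_mul
            (10 / (1 + Real.log Q))
          refine hd.congr_deriv ?_
          simp only [id]
          rw [← hqq]
          field_simp
        · intro x; positivity
        · intro x
          try simp only
          rw [← mul_neg, ← neg_div]
          gcongr
          linarith [Real.neg_pi_div_two_lt_arctan (x / q), Real.pi_lt_four]
        · intro x
          try simp only
          gcongr
          linarith [Real.arctan_lt_pi_div_two (x / q), Real.pi_lt_four]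
    _ = ENNReal.ofReal (40 / (q * (1 + Real.log Q))) := by congr 1; field_simp; norm_num
    _ ≤ _ := by
        apply ENNReal.ofReal_le_ofReal
        unfold JJ
        calc 40 / (q * (1 + Real.log Q)) ≤ 40 / ((1 + |x1|) / 2 * ((1 + Real.log (1 + |x1|)) / 4)) := by
              gcongr
          _ = _ := by field_simp; norm_num

lemma meas_Psi : Measurable Psi := by
  unfold Psi ell TT; fun_prop

lemma meas_JJ : Measurable JJ := by unfold JJ; fun_prop

lemma int_Psi (w : ℝ → ENNReal) (hw : Measurable w) (τ : ℝ) :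
    ∫⁻ x in {p : ℝ × ℝ × ℝ | 0 < p.2.2}, w x.1 * ENNReal.ofReal (Psi (sh τ x)) ≤
      ∫⁻ x1, w x1 * ENNReal.ofReal (JJ (x1 - τ)) := by
  have hset : {p : ℝ × ℝ × ℝ | 0 < p.2.2} = univ ×ˢ (univ ×ˢ Ioi (0 : ℝ)) := by
    ext p; simp
  have hmP : Measurable fun x : ℝ × ℝ × ℝ => Psi (sh τ x) :=
    meas_Psi.comp (by unfold sh; fun_prop)
  rw [hset, Measure.volume_eq_prod, ← Measure.prod_restrict, Measure.restrict_univ,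
    lintegral_prod _ (by fun_prop)]
  refine lintegral_mono fun x1 => ?_
  have hm1 : Measurable fun y : ℝ × ℝ => Psi (sh τ (x1, y)) :=
    hmP.comp measurable_prodMk_left
  try simp only
  rw [lintegral_const_mul _ (by fun_prop)]
  gcongr
  rw [Measure.volume_eq_prod, ← Measure.prod_restrict, Measure.restrict_univ,
    lintegral_prod _ hm1.ennreal_ofReal.aemeasurable]
  refine le_trans (lintegral_mono fun x2 => ?_) (int_x2 (x1 - τ))
  exact int_a (x1 - τ) x2

lemma lint_abs_le (f : ℝ → ENNReal) :
    ∫⁻ x, f |x| ≤ 2 * ∫⁻ x in Ici (0 : ℝ), f x := by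
  have h1 : ∫⁻ x in Ici (0 : ℝ), f |x| = ∫⁻ x in Ici (0 : ℝ), f x :=
    setLIntegral_congr_fun measurableSet_Ici fun x hx => by rw [abs_of_nonneg hx]
  have h2 : ∫⁻ x in Iic (0 : ℝ), f |x| = ∫⁻ x in Ici (0 : ℝ), f x := by
    have hp := (Measure.measurePreserving_neg (volume : Measure ℝ)).setLIntegral_comp_preimage_emb
      (MeasurableEquiv.neg ℝ).measurableEmbedding (fun x => f |x|) (Ici 0)
    simp only [abs_neg] at hp
    rw [← h1, ← hp]
    congr 2
    ext x; simp
  calc ∫⁻ x, f |x| = ∫⁻ x in Iic (0 : ℝ) ∪ Ici 0, f |x| := by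
        rw [Iic_union_Ici, setLIntegral_univ]
    _ ≤ _ := lintegral_union_le _ _ _
    _ = _ := by rw [h1, h2, two_mul]

lemma near_int {R : ℝ} (hR : 0 < R) :
    ∫⁻ x, (Icc (-R) R).indicator 1 x * ENNReal.ofReal (JJ x) ≤
      ENNReal.ofReal (640 * Real.log (1 + Real.log (1 + R))) := by
  have hl : ∀ x : ℝ, 0 ≤ x → 0 ≤ Real.log (1 + x) := fun x hx => Real.log_nonneg (by linarith)
  have hI : ∫⁻ x in Icc (0 : ℝ) R, ENNReal.ofReal (320 / ((1 + x) * (1 + Real.log (1 + x)))) ≤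
      ENNReal.ofReal (320 * Real.log (1 + Real.log (1 + R)) - 0) := by
    refine ftc_le (fun _ => 0) (fun _ => R) (fun _ _ _ => le_rfl) (fun _ _ _ => le_rfl)
      (fun _ => hR.le) (fun x hx => mem_iUnion.2 ⟨0, hx⟩) (fun _ => Subset.rfl)
      (F := fun x => 320 * Real.log (1 + Real.log (1 + x))) ?_ ?_ ?_ ?_
    · intro x hx
      have h0 := hx.1
      have := hl x hx.1
      have d1 := (hasDerivAt_id x).const_add 1
      have d2 := (d1.log (by simp only [id]; positivity)).const_add 1
      have d3 := (d2.log (by simp only [id]; positivity)).const_mul 320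
      refine d3.congr_deriv ?_
      simp only [id]
      field_simp
    · intro x hx
      have h0 := hx.1
      have := hl x hx.1
      positivity
    · intro x hx
      have := hl _ (hl x hx.1)
      positivity
    · intro x hx
      have h0 := hx.1
      have := hl x hx.1
      have := hx.2
      have : Real.log (1 + x) ≤ Real.log (1 + R) := Real.log_le_log (by linarith) (by linarith)
      have : Real.log (1 + Real.log (1 + x)) ≤ Real.log (1 + Real.log (1 + R)) :=
        Real.log_le_log (by linarith) (by linarith)
      linarith
  have := lint_abs_le fun x => (Iic R).indicator
    (fun x => ENNReal.ofReal (320 / ((1 + x) * (1 + Real.log (1 + x))))) x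
  calc _ = ∫⁻ x : ℝ, (Iic R).indicator
        (fun x => ENNReal.ofReal (320 / ((1 + x) * (1 + Real.log (1 + x))))) |x| := by
        refine lintegral_congr fun x => ?_
        by_cases h : |x| ≤ R
        · rw [indicator_of_mem (show x ∈ Icc (-R) R from abs_le.1 h),
            indicator_of_mem (show |x| ∈ Iic R from h), JJ]
          simp
        · rw [indicator_of_notMem (show x ∉ Icc (-R) R from fun h' => h (abs_le.2 h')),
            indicator_of_notMem (show |x| ∉ Iic R from h)]
          simp
    _ ≤ _ := this
    _ ≤ 2 * ENNReal.ofReal (320 * Real.log (1 + Real.log (1 + R)) - 0) := by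
        gcongr
        rw [setLIntegral_indicator measurableSet_Iic, inter_comm, Ici_inter_Iic]
        exact hI
    _ = _ := by
        rw [show (2 : ENNReal) = ENNReal.ofReal 2 by simp, ← ENNReal.ofReal_mul (by norm_num)]
        congr 1; ring

lemma far_int {L : ℝ} (hL : 0 < L) :
    ∫⁻ x, {x : ℝ | 2 * L < |x|}.indicator (fun x => ENNReal.ofReal (L / |x|)) x *
      ENNReal.ofReal (JJ x) ≤ ENNReal.ofReal 320 := by
  have hI : ∫⁻ x in Ioi (2 * L), ENNReal.ofReal (320 * L / x ^ 2) ≤ ENNReal.ofReal (0 - (-160)) := by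
    refine ftc_Ioi (F := fun x => -(320 * L * x⁻¹)) ?_ ?_ ?_ ?_
    · intro x hx
      rw [mem_Ioi] at hx
      have h0 : 0 < x := by linarith
      refine (((hasDerivAt_inv h0.ne').const_mul (320 * L)).neg).congr_deriv ?_
      field_simp
    · intro x hx; positivity
    · intro x hx
      rw [mem_Ioi] at hx
      have h0 : 0 < x := by linarith
      have : x⁻¹ ≤ (2 * L)⁻¹ := inv_anti₀ (by linarith) hx.le
      have : 320 * L * x⁻¹ ≤ 320 * L * (2 * L)⁻¹ := by gcongr
      have e : 320 * L * (2 * L)⁻¹ = 160 := by field_simp; norm_num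
      linarith
    · intro x hx
      rw [mem_Ioi] at hx
      have h0 : 0 < x := by linarith
      have : 0 ≤ 320 * L * x⁻¹ := by positivity
      linarith
  have := lint_abs_le fun x => (Ioi (2 * L)).indicator (fun x => ENNReal.ofReal (320 * L / x ^ 2)) x
  calc _ ≤ ∫⁻ x : ℝ, (Ioi (2 * L)).indicator (fun x => ENNReal.ofReal (320 * L / x ^ 2)) |x| := by
        refine lintegral_mono fun x => ?_
        by_cases h : 2 * L < |x|
        · simp only
          rw [indicator_of_mem (show x ∈ {x : ℝ | 2 * L < |x|} from h),
            indicator_of_mem (show |x| ∈ Ioi (2 * L) from h)]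
          have h0 : 0 < |x| := by linarith
          rw [← ENNReal.ofReal_mul (by positivity)]
          apply ENNReal.ofReal_le_ofReal
          have hl : 0 ≤ Real.log (1 + |x|) := Real.log_nonneg (by linarith)
          unfold JJ
          calc L / |x| * (320 / ((1 + |x|) * (1 + Real.log (1 + |x|))))
              ≤ L / |x| * (320 / (|x| * 1)) := by gcongr <;> linarith
            _ = _ := by field_simp
        · simp only
          rw [indicator_of_notMem (show x ∉ {x : ℝ | 2 * L < |x|} from h)]
          simp
    _ ≤ _ := this
    _ ≤ 2 * ENNReal.ofReal (0 - (-160)) := by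
        gcongr
        rw [setLIntegral_indicator measurableSet_Ioi]
        refine le_trans (lintegral_mono_set inter_subset_left) hI
    _ = _ := by
        rw [show (2 : ENNReal) = ENNReal.ofReal 2 by simp, ← ENNReal.ofReal_mul (by norm_num)]
        congr 1; norm_num

lemma meas_sh (L : ℝ) : Measurable (sh L) := by unfold sh; fun_prop

lemma mp_sh_vol (L : ℝ) : MeasurePreserving (sh L) (volume : Measure (ℝ × ℝ × ℝ)) volume :=
  (measurePreserving_sub_right (volume : Measure ℝ) L).prod (MeasurePreserving.id volume)

lemma meas_G : MeasurableSet {p : ℝ × ℝ × ℝ | 0 < p.2.2} :=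
  measurableSet_lt measurable_const (by fun_prop)

lemma mp_sh (L : ℝ) : MeasurePreserving (sh L) lG lG := by
  refine ⟨meas_sh L, ?_⟩
  have hd : Measurable ({p : ℝ × ℝ × ℝ | 0 < p.2.2}.indicator
      (fun p => ENNReal.ofReal ((p.2.2) ^ 3)⁻¹)) :=
    Measurable.indicator (by fun_prop) meas_G
  have e : lG = (volume : Measure (ℝ × ℝ × ℝ)).withDensity
      ({p : ℝ × ℝ × ℝ | 0 < p.2.2}.indicator (fun p => ENNReal.ofReal ((p.2.2) ^ 3)⁻¹)) := by
    rw [withDensity_indicator meas_G]; rfl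
  rw [e]
  ext s hs
  rw [Measure.map_apply (meas_sh L) hs, withDensity_apply _ hs, withDensity_apply _ (meas_sh L hs),
    ← (mp_sh_vol L).setLIntegral_comp_preimage hs hd]
  rfl

lemma meas_P0 : MeasurableSet P0 := by
  have : P0 = Icc (-1 : ℝ) 1 ×ˢ (Icc (-1 : ℝ) 1 ×ˢ Icc (Real.exp (-1)) (Real.exp 1)) := by
    rfl
  rw [this]
  exact measurableSet_Icc.prod (measurableSet_Icc.prod measurableSet_Icc)

lemma lG_P0 : lG P0 < ⊤ := by
  have hK : IsCompact P0 := by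
    have : P0 = Icc (-1 : ℝ) 1 ×ˢ (Icc (-1 : ℝ) 1 ×ˢ Icc (Real.exp (-1)) (Real.exp 1)) := by
      rfl
    rw [this]
    exact isCompact_Icc.prod (isCompact_Icc.prod isCompact_Icc)
  rw [lG, withDensity_apply _ meas_P0]
  calc _ ≤ ∫⁻ p in P0, ENNReal.ofReal 27 ∂(volume.restrict {p : ℝ × ℝ × ℝ | 0 < p.2.2}) := by
        refine setLIntegral_mono' meas_P0 fun p hp => ENNReal.ofReal_le_ofReal ?_
        obtain ⟨-, -, h3, -⟩ := P0_bd hp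
        calc ((p.2.2) ^ 3)⁻¹ ≤ ((1 / 3 : ℝ) ^ 3)⁻¹ := by gcongr
          _ = 27 := by norm_num
    _ = ENNReal.ofReal 27 * (volume.restrict {p : ℝ × ℝ × ℝ | 0 < p.2.2}) P0 := by
        rw [setLIntegral_const]
    _ < ⊤ := by
        refine ENNReal.mul_lt_top ENNReal.ofReal_lt_top ?_
        exact (Measure.restrict_apply_le _ _).trans_lt hK.measure_lt_top

lemma meas_kk (i : ℕ) (x : ℝ × ℝ × ℝ) : Measurable fun y => kk i (ginvMul y x) := by
  have hg : Measurable fun y => ginvMul y x := by unfold ginvMul; fun_prop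
  have hc : Measurable chD := by unfold chD; fun_prop
  have hr : Measurable rD := by unfold rD; fun_prop
  have hk : Measurable (kk i) := by
    match i with
    | 0 => simp only [kk]; unfold k0; fun_prop
    | 1 => simp only [kk]; unfold k1; fun_prop
    | (n + 2) => simp only [kk]; unfold k2; fun_prop
  exact hk.comp hg

lemma integrable_base (i : ℕ) {x : ℝ × ℝ × ℝ} (ha : 0 < x.2.2) (hx : x ∉ twoP0) :
    IntegrableOn (fun y => kk i (ginvMul y x)) P0 lG :=
  Measure.integrableOn_of_bounded lG_P0.ne (meas_kk i x).aestronglyMeasurable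
    ((ae_restrict_iff' meas_P0).2 (Filter.Eventually.of_forall fun y hy => by
      rw [Real.norm_eq_abs]; exact kk_bound hy ha hx i))

lemma fL_mul (L : ℝ) (i : ℕ) (x : ℝ × ℝ × ℝ) :
    (fun y => fL L y * kk i (ginvMul y x)) = fun y =>
      P0.indicator (fun y => kk i (ginvMul y (sh L x))) (sh L y) -
        P0.indicator (fun y => kk i (ginvMul y x)) y := by
  have hg : ∀ y, ginvMul (sh L y) (sh L x) = ginvMul y x := by
    intro y; simp only [ginvMul, sh, sub_sub_sub_cancel_right]
  have hP : ∀ y, y ∈ PL L ↔ sh L y ∈ P0 := by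
    intro y
    simp only [PL, P0, sh, mem_ofPred_eq, mem_Icc]
    constructor
    · rintro ⟨⟨h1, h2⟩, h3⟩; exact ⟨⟨by linarith, by linarith⟩, h3⟩
    · rintro ⟨⟨h1, h2⟩, h3⟩; exact ⟨⟨by linarith, by linarith⟩, h3⟩
  funext y
  rw [fL, sub_mul]
  congr 1
  · by_cases h : y ∈ PL L
    · rw [indicator_of_mem h, indicator_of_mem ((hP y).1 h), hg]; simp
    · rw [indicator_of_notMem h, indicator_of_notMem (fun h' => h ((hP y).2 h'))]; simp
  · by_cases h : y ∈ P0
    · rw [indicator_of_mem h, indicator_of_mem h]; simp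
    · rw [indicator_of_notMem h, indicator_of_notMem h]; simp

lemma main_split {L : ℝ} (i : ℕ) {x : ℝ × ℝ × ℝ} (ha : 0 < x.2.2) (hx : x ∉ twoP0)
    (hx' : sh L x ∉ twoP0) :
    Integrable (fun y => fL L y * kk i (ginvMul y x)) lG ∧
    ∫ y, fL L y * kk i (ginvMul y x) ∂lG =
      ∫ y in P0, (kk i (ginvMul y (sh L x)) - kk i (ginvMul y x)) ∂lG := by
  have i1 := integrable_base i (x := sh L x) ha hx'
  have i2 := integrable_base i ha hx
  have j1 := (integrable_indicator_iff meas_P0).2 i1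
  have j2 := (integrable_indicator_iff meas_P0).2 i2
  have j1' := (mp_sh L).integrable_comp_of_integrable j1
  rw [fL_mul]
  refine ⟨j1'.sub j2, ?_⟩
  have es := integral_sub j1' j2
  simp only [Function.comp_apply] at es
  rw [es, integral_sub i1 i2, ← integral_indicator meas_P0,
    ← integral_indicator meas_P0]
  congr 1
  have hm : Measurable (P0.indicator (fun y => kk i (ginvMul y (sh L x)))) :=
    (meas_kk i _).indicator meas_P0
  have := integral_map (μ := lG) (meas_sh L).aemeasurable
    (f := P0.indicator (fun y => kk i (ginvMul y (sh L x)))) hm.aestronglyMeasurable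
  rw [(mp_sh L).map_eq] at this
  exact this.symm

lemma sh_not {L : ℝ} {x : ℝ × ℝ × ℝ} (hx : x ∉ twoPL L) : sh L x ∉ twoP0 := by
  intro h
  apply hx
  obtain ⟨⟨h1, h2⟩, h3⟩ := h
  simp only [sh] at h1 h2
  exact ⟨⟨by linarith, by linarith⟩, h3⟩

lemma meas_twoP0 : MeasurableSet twoP0 := by
  have : twoP0 = Icc (-2 : ℝ) 2 ×ˢ (Icc (-2 : ℝ) 2 ×ˢ Icc (Real.exp (-2)) (Real.exp 2)) := by
    rfl
  rw [this]
  exact measurableSet_Icc.prod (measurableSet_Icc.prod measurableSet_Icc)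

lemma meas_twoPL (L : ℝ) : MeasurableSet (twoPL L) := by
  have : twoPL L = Icc (L - 2 : ℝ) (L + 2) ×ˢ (Icc (-2 : ℝ) 2 ×ˢ Icc (Real.exp (-2)) (Real.exp 2)) := by
    rfl
  rw [this]
  exact measurableSet_Icc.prod (measurableSet_Icc.prod measurableSet_Icc)

def w1 (L : ℝ) : ℝ → ENNReal := (Icc (-(2 * L)) (2 * L)).indicator 1
def w2 (L : ℝ) : ℝ → ENNReal := {x : ℝ | 2 * L < |x|}.indicator (fun x => ENNReal.ofReal (L / |x|))

lemma meas_w1 (L : ℝ) : Measurable (w1 L) := measurable_one.indicator measurableSet_Icc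
lemma meas_w2 (L : ℝ) : Measurable (w2 L) :=
  Measurable.indicator (by fun_prop) (measurableSet_lt measurable_const (by fun_prop))

lemma pt_bound {L : ℝ} (hL : 2 < L) (i : ℕ) {x : ℝ × ℝ × ℝ} (ha : 0 < x.2.2) (hx : x ∉ twoP0)
    (hx' : sh L x ∉ twoP0) :
    ENNReal.ofReal |∫ y, fL L y * kk i (ginvMul y x) ∂lG| ≤
      ENNReal.ofReal x.2.2 * (ENNReal.ofReal (10 ^ 25 * lG.real P0) *
        (w1 L x.1 * ENNReal.ofReal (Psi (sh 0 x)) + w1 L x.1 * ENNReal.ofReal (Psi (sh L x))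
          + w2 L x.1 * ENNReal.ofReal (Psi (sh 0 x)))) := by
  have hs0 : sh 0 x = x := by simp [sh]
  rw [hs0, (main_split i ha hx hx').2]
  have P := Psi_nonneg ha
  have P' : 0 ≤ Psi (sh L x) := Psi_nonneg (x := sh L x) ha
  have hΛ : 0 ≤ lG.real P0 := measureReal_nonneg
  by_cases h : |x.1| ≤ 2 * L
  · have e1 : w1 L x.1 = 1 :=
      indicator_of_mem (show x.1 ∈ Icc (-(2 * L)) (2 * L) from abs_le.1 h) _
    have e2 : w2 L x.1 = 0 := indicator_of_notMem (by simpa using h) _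
    rw [e1, e2, one_mul, one_mul, zero_mul, add_zero, ← ENNReal.ofReal_add P P',
      ← ENNReal.ofReal_mul (by positivity), ← ENNReal.ofReal_mul ha.le]
    apply ENNReal.ofReal_le_ofReal
    have := norm_setIntegral_le_of_norm_le_const (μ := lG) (s := P0)
      (f := fun y => kk i (ginvMul y (sh L x)) - kk i (ginvMul y x))
      (C := 10 ^ 25 * (x.2.2 * (Psi x + Psi (sh L x)))) lG_P0 (by
        intro y hy
        have b1 := kk_bound hy ha hx i
        have b2 := kk_bound (x := sh L x) hy ha hx' i
        rw [Real.norm_eq_abs]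
        refine (abs_sub _ _).trans ?_
        have e : (sh L x).2.2 = x.2.2 := rfl
        rw [e] at b2
        have q1 := mul_nonneg ha.le P
        have q2 := mul_nonneg ha.le P'
        nlinarith)
    rw [Real.norm_eq_abs] at this
    refine this.trans (le_of_eq ?_)
    ring
  · have e1 : w1 L x.1 = 0 := 
      indicator_of_notMem (show x.1 ∉ Icc (-(2 * L)) (2 * L) from fun h' => h (abs_le.2 h')) _
    push Not at h
    have e2 : w2 L x.1 = ENNReal.ofReal (L / |x.1|) := 
      indicator_of_mem (show x.1 ∈ {x : ℝ | 2 * L < |x|} from h) _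
    have h0 : 0 < L / |x.1| := div_pos (by linarith) (by linarith)
    rw [e1, e2, zero_mul, zero_mul, zero_add, zero_add, ← ENNReal.ofReal_mul h0.le,
      ← ENNReal.ofReal_mul (by positivity), ← ENNReal.ofReal_mul ha.le]
    apply ENNReal.ofReal_le_ofReal
    have := norm_setIntegral_le_of_norm_le_const (μ := lG) (s := P0)
      (f := fun y => kk i (ginvMul y (sh L x)) - kk i (ginvMul y x))
      (C := 10 ^ 25 * (L / |x.1|) * (x.2.2 * Psi x)) lG_P0 (fun y hy => by
        rw [Real.norm_eq_abs]; exact kk_diff hL hy ha h i)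
    rw [Real.norm_eq_abs] at this
    refine this.trans (le_of_eq ?_)
    ring

lemma loglog {L : ℝ} (hL : 100 < L) : 1 ≤ Real.log (Real.log L) ∧
    Real.log (1 + Real.log (1 + 3 * L)) ≤ 2 * Real.log (Real.log L) := by
  have he := Real.exp_one_lt_d9
  have h3 : 3 ≤ Real.log L := by
    rw [Real.le_log_iff_exp_le (by linarith)]
    have : Real.exp 3 = Real.exp 1 ^ 3 := by rw [← Real.exp_nat_mul]; norm_num
    rw [this]
    calc Real.exp 1 ^ 3 ≤ 3 ^ 3 := by gcongr; linarith
      _ ≤ L := by linarith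
  constructor
  · rw [Real.le_log_iff_exp_le (by linarith)]; linarith
  · have h1 : Real.log (1 + 3 * L) ≤ 2 * Real.log L := by
      have : Real.log (1 + 3 * L) ≤ Real.log (L ^ 2) := Real.log_le_log (by linarith) (by nlinarith)
      rwa [Real.log_pow] at this
    have h0 : 0 ≤ Real.log (1 + 3 * L) := Real.log_nonneg (by linarith)
    have : Real.log (1 + Real.log (1 + 3 * L)) ≤ Real.log (Real.log L ^ 2) :=
      Real.log_le_log (by linarith) (by nlinarith)
    rwa [Real.log_pow] at this

lemma total_int {L : ℝ} (hL : 100 < L) :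
    ∫⁻ x in {p : ℝ × ℝ × ℝ | 0 < p.2.2},
        (w1 L x.1 * ENNReal.ofReal (Psi (sh 0 x)) + w1 L x.1 * ENNReal.ofReal (Psi (sh L x))
          + w2 L x.1 * ENNReal.ofReal (Psi (sh 0 x))) ≤
      ENNReal.ofReal (3000 * Real.log (Real.log L)) := by
  obtain ⟨l1, l2⟩ := loglog hL
  have m0 : ∀ τ, Measurable fun x : ℝ × ℝ × ℝ => Psi (sh τ x) := fun τ => meas_Psi.comp (meas_sh τ)
  have mw1 := meas_w1 L
  have mw2 := meas_w2 L
  have mA : Measurable fun x : ℝ × ℝ × ℝ => w1 L x.1 * ENNReal.ofReal (Psi (sh 0 x)) :=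
    (mw1.comp measurable_fst).mul (m0 0).ennreal_ofReal
  have mB : Measurable fun x : ℝ × ℝ × ℝ => w1 L x.1 * ENNReal.ofReal (Psi (sh L x)) :=
    (mw1.comp measurable_fst).mul (m0 L).ennreal_ofReal
  have mono1 : ∀ x τ : ℝ, (τ = 0 ∨ τ = L) → w1 L x ≤ (Icc (-(3 * L)) (3 * L)).indicator 1 (x - τ) := by
    intro x τ hτ
    by_cases hx : x ∈ Icc (-(2 * L)) (2 * L)
    · have hx2 : x - τ ∈ Icc (-(3 * L)) (3 * L) := by
        have h1 := hx.1
        have h2 := hx.2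
        rcases hτ with h | h <;> rw [h] <;> constructor <;> linarith
      rw [w1, indicator_of_mem hx, indicator_of_mem hx2]
      simp
    · rw [w1, indicator_of_notMem hx]
      exact zero_le
  have near : ∀ τ : ℝ, (τ = 0 ∨ τ = L) →
      ∫⁻ x1, w1 L x1 * ENNReal.ofReal (JJ (x1 - τ)) ≤
        ENNReal.ofReal (1280 * Real.log (Real.log L)) := by
    intro τ hτ
    calc _ ≤ ∫⁻ x1, (fun x => (Icc (-(3 * L)) (3 * L)).indicator 1 x * ENNReal.ofReal (JJ x)) (x1 - τ) := by
          refine lintegral_mono fun x1 => ?_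
          exact mul_le_mul_left (mono1 x1 τ hτ) _
      _ = ∫⁻ x1, (Icc (-(3 * L)) (3 * L)).indicator 1 x1 * ENNReal.ofReal (JJ x1) :=
          
          lintegral_sub_right_eq_self (μ := (volume : Measure ℝ))
            (fun x => (Icc (-(3 * L)) (3 * L)).indicator 1 x * ENNReal.ofReal (JJ x)) τ
      _ ≤ _ := near_int (by linarith)
      _ ≤ _ := ENNReal.ofReal_le_ofReal (by linarith)
  have far := far_int (L := L) (by linarith)
  have mAB : Measurable fun x : ℝ × ℝ × ℝ =>
      w1 L x.1 * ENNReal.ofReal (Psi (sh 0 x)) + w1 L x.1 * ENNReal.ofReal (Psi (sh L x)) := mA.add mB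
  rw [lintegral_add_left mAB, lintegral_add_left mA]
  calc _ ≤ ENNReal.ofReal (1280 * Real.log (Real.log L)) + ENNReal.ofReal (1280 * Real.log (Real.log L))
        + ENNReal.ofReal 320 := by
        refine add_le_add (add_le_add ?_ ?_) ?_
        · exact (int_Psi _ mw1 0).trans (near 0 (Or.inl rfl))
        · exact (int_Psi _ mw1 L).trans (near L (Or.inr rfl))
        · refine (int_Psi _ mw2 0).trans ?_
          simp only [sub_zero]
          exact far
    _ ≤ _ := by
        rw [← ENNReal.ofReal_add (by linarith) (by linarith), ← ENNReal.ofReal_add (by linarith) (by norm_num)]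
        exact ENNReal.ofReal_le_ofReal (by linarith)

/-- for large `L`, the function `R_i f_L = f_L ∗ k_i` is well defined outside
`2P₀ ∪ 2P_L` and its `L¹`-norm there is `≲ log log L`. -/
theorem stmt9 :
    ∃ C : ℝ, 0 < C ∧ ∀ L : ℝ, C < L → ∀ i : ℕ, i ≤ 2 →
      (∀ x ∈ {p : ℝ × ℝ × ℝ | 0 < p.2.2} \ (twoP0 ∪ twoPL L),
        Integrable (fun y => fL L y * kk i (ginvMul y x)) lG) ∧
      ∫⁻ x in {p : ℝ × ℝ × ℝ | 0 < p.2.2} \ (twoP0 ∪ twoPL L),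
        ENNReal.ofReal |∫ y, fL L y * kk i (ginvMul y x) ∂lG| ∂ρG
        ≤ ENNReal.ofReal (C * Real.log (Real.log L)) := by
  have hΛ : 0 ≤ lG.real P0 := measureReal_nonneg
  refine ⟨10 ^ 25 * lG.real P0 * 3000 + 100, by positivity, fun L hL i _ => ?_⟩
  have hL100 : 100 < L := by
    have : 0 ≤ 10 ^ 25 * lG.real P0 * 3000 := by positivity
    linarith
  obtain ⟨l1, l2⟩ := loglog hL100
  refine ⟨fun x hx => ?_, ?_⟩
  · have h1 : x ∉ twoP0 := fun h => hx.2 (Or.inl h)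
    have h2 : x ∉ twoPL L := fun h => hx.2 (Or.inr h)
    exact (main_split i hx.1 h1 (sh_not h2)).1
  have m0 : ∀ τ, Measurable fun x : ℝ × ℝ × ℝ => Psi (sh τ x) := fun τ => meas_Psi.comp (meas_sh τ)
  have mw1 := meas_w1 L
  have mw2 := meas_w2 L
  set N : ℝ × ℝ × ℝ → ENNReal := fun x =>
    w1 L x.1 * ENNReal.ofReal (Psi (sh 0 x)) + w1 L x.1 * ENNReal.ofReal (Psi (sh L x))
          + w2 L x.1 * ENNReal.ofReal (Psi (sh 0 x)) with hN
  have mN : Measurable N :=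
    (((mw1.comp measurable_fst).mul (m0 0).ennreal_ofReal).add
      ((mw1.comp measurable_fst).mul (m0 L).ennreal_ofReal)).add
      ((mw2.comp measurable_fst).mul (m0 0).ennreal_ofReal)
  calc _ ≤ ∫⁻ x in {p : ℝ × ℝ × ℝ | 0 < p.2.2} \ (twoP0 ∪ twoPL L),
        ENNReal.ofReal x.2.2 * (ENNReal.ofReal (10 ^ 25 * lG.real P0) * N x) ∂ρG := by
        refine setLIntegral_mono' (meas_G.diff (meas_twoP0.union (meas_twoPL L))) fun x hx => ?_
        have h1 : x ∉ twoP0 := fun h => hx.2 (Or.inl h)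
        have h2 : x ∉ twoPL L := fun h => hx.2 (Or.inr h)
        exact pt_bound (by linarith) i hx.1 h1 (sh_not h2)
    _ ≤ ∫⁻ x, ENNReal.ofReal x.2.2 * (ENNReal.ofReal (10 ^ 25 * lG.real P0) * N x) ∂ρG :=
        setLIntegral_le_lintegral _ _
    _ = ∫⁻ x in {p : ℝ × ℝ × ℝ | 0 < p.2.2}, ENNReal.ofReal (10 ^ 25 * lG.real P0) * N x := by
        rw [ρG, lintegral_withDensity_eq_lintegral_mul _ (by fun_prop) (by fun_prop)]
        refine setLIntegral_congr_fun meas_G fun x hx => ?_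
        have hx0 : 0 < x.2.2 := hx
        simp only [Pi.mul_apply]
        rw [← mul_assoc, ← ENNReal.ofReal_mul (by positivity), inv_mul_cancel₀ hx0.ne',
          ENNReal.ofReal_one, one_mul]
    _ = ENNReal.ofReal (10 ^ 25 * lG.real P0) * ∫⁻ x in {p : ℝ × ℝ × ℝ | 0 < p.2.2}, N x :=
        lintegral_const_mul _ mN
    _ ≤ ENNReal.ofReal (10 ^ 25 * lG.real P0) * ENNReal.ofReal (3000 * Real.log (Real.log L)) := by
        gcongr
        exact total_int hL100
    _ ≤ _ := by
        rw [← ENNReal.ofReal_mul (by positivity)]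
        apply ENNReal.ofReal_le_ofReal
        nlinarith
end
end

section
/- There exist constants C > 0 and N > 0 such that for every L ≥ C, every x = (x₁,x₂,a) ∈ G with r(x) > (log L)², and every y ∈ P₀, one has |k₀(y⁻¹·(−L,0,1)·x) − k₀(y⁻¹x)| ≤ C L^N [ (1+|x|)/(a r(x) sinh³ r(x)) + (1+|x|)/(a² r(x)² sinh² r(x)) ]. -/
open Real MeasureTheory Set

noncomputable section

/-- the first radial profile -/
def FF (r : ℝ) : ℝ := 1 / (r ^ 2 * Real.sinh r ^ 2) + Real.cosh r / (r * Real.sinh r ^ 3)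

/-- the second radial profile -/
def HH (r : ℝ) : ℝ := Real.cosh r / (r ^ 2 * Real.sinh r ^ 2) + 1 / (r * Real.sinh r ^ 3)

lemma cosh_le_two_sinh {r : ℝ} (hr : 1 ≤ r) : Real.cosh r ≤ 2 * Real.sinh r := by
  have h1 : r + 1 ≤ Real.exp r := Real.add_one_le_exp r
  have h2 : Real.exp r * Real.exp (-r) = 1 := by rw [← Real.exp_add]; simp
  have h3 : 0 < Real.exp (-r) := Real.exp_pos _
  rw [Real.cosh_eq, Real.sinh_eq]
  nlinarith

lemma self_le_sinh' {r : ℝ} (hr : 1 ≤ r) : r ≤ Real.sinh r :=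
  Real.self_le_sinh_iff.2 (by linarith)

lemma FF_deriv {r : ℝ} (hr : 1 ≤ r) :
    HasDerivAt FF (-2 / (r ^ 3 * Real.sinh r ^ 2) - 2 * Real.cosh r / (r ^ 2 * Real.sinh r ^ 3)
      + (1 / (r * Real.sinh r ^ 2) - Real.cosh r / (r ^ 2 * Real.sinh r ^ 3)
        - 3 * Real.cosh r ^ 2 / (r * Real.sinh r ^ 4))) r := by
  have hs := self_le_sinh' hr
  have hr0 : r ≠ 0 := by positivity
  have hs0 : Real.sinh r ≠ 0 := by linarith
  have e1 := (hasDerivAt_const r (1:ℝ)).div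
    (((hasDerivAt_id r).pow 2).mul ((Real.hasDerivAt_sinh r).pow 2)) (by simp; tauto)
  have e2 := (Real.hasDerivAt_cosh r).div
    ((hasDerivAt_id r).mul ((Real.hasDerivAt_sinh r).pow 3)) (by simp; tauto)
  have e := e1.add e2
  refine e.congr_deriv ?_
  simp
  field_simp
  ring

lemma HH_deriv {r : ℝ} (hr : 1 ≤ r) :
    HasDerivAt HH ((1 / (r ^ 2 * Real.sinh r) - 2 * Real.cosh r / (r ^ 3 * Real.sinh r ^ 2)
      - 2 * Real.cosh r ^ 2 / (r ^ 2 * Real.sinh r ^ 3))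
      + (-1 / (r ^ 2 * Real.sinh r ^ 3) - 3 * Real.cosh r / (r * Real.sinh r ^ 4))) r := by
  have hs := self_le_sinh' hr
  have hr0 : r ≠ 0 := by positivity
  have hs0 : Real.sinh r ≠ 0 := by linarith
  have e1 := (Real.hasDerivAt_cosh r).div
    (((hasDerivAt_id r).pow 2).mul ((Real.hasDerivAt_sinh r).pow 2)) (by simp; tauto)
  have e2 := (hasDerivAt_const r (1:ℝ)).div
    ((hasDerivAt_id r).mul ((Real.hasDerivAt_sinh r).pow 3)) (by simp; tauto)
  have e := e1.add e2
  refine e.congr_deriv ?_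
  simp
  field_simp
  ring

lemma alg_F {r s c : ℝ} (hr : 1 ≤ r) (hrs : r ≤ s) (hc : 0 ≤ c) (hcs : c ≤ 2 * s) :
    |(-2 / (r ^ 3 * s ^ 2) - 2 * c / (r ^ 2 * s ^ 3)
      + (1 / (r * s ^ 2) - c / (r ^ 2 * s ^ 3) - 3 * c ^ 2 / (r * s ^ 4)))| ≤ 21 / (r * s ^ 2) := by
  have hr0 : 0 < r := by linarith
  have hs0 : 0 < s := by linarith
  have a1 : 2 / (r ^ 3 * s ^ 2) ≤ 2 / (r * s ^ 2) := by
    gcongr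
    exact le_self_pow₀ hr (by norm_num)
  have b2 : c / (r ^ 2 * s ^ 3) ≤ 2 / (r * s ^ 2) := by
    rw [div_le_div_iff₀ (by positivity) (by positivity)]
    have : c * r ≤ 2 * s * r ^ 2 := by
      have : r ≤ r ^ 2 := by nlinarith
      gcongr
    nlinarith [mul_le_mul_of_nonneg_right this (sq_nonneg s)]
  have b3 : 3 * c ^ 2 / (r * s ^ 4) ≤ 12 / (r * s ^ 2) := by
    rw [div_le_div_iff₀ (by positivity) (by positivity)]
    have : c ^ 2 ≤ (2 * s) ^ 2 := by gcongr
    have h : 0 ≤ r * s ^ 2 := by positivity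
    nlinarith [mul_le_mul_of_nonneg_right this h]
  have p1 : 0 ≤ 2 / (r ^ 3 * s ^ 2) := by positivity
  have p2 : 0 ≤ c / (r ^ 2 * s ^ 3) := by positivity
  have p3 : 0 ≤ 3 * c ^ 2 / (r * s ^ 4) := by positivity
  have p4 : 0 ≤ 1 / (r * s ^ 2) := by positivity
  have q1 : -2 / (r ^ 3 * s ^ 2) = - (2 / (r ^ 3 * s ^ 2)) := by ring
  have q2 : 2 * c / (r ^ 2 * s ^ 3) = 2 * (c / (r ^ 2 * s ^ 3)) := by ring
  have q3 : 2 / (r * s ^ 2) = 2 * (1 / (r * s ^ 2)) := by ring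
  have q4 : 12 / (r * s ^ 2) = 12 * (1 / (r * s ^ 2)) := by ring
  have q5 : 21 / (r * s ^ 2) = 21 * (1 / (r * s ^ 2)) := by ring
  rw [q1, q2, q5]
  rw [q3] at a1 b2
  rw [q4] at b3
  rw [abs_le]
  constructor <;> linarith

lemma alg_H {r s c : ℝ} (hr : 1 ≤ r) (hrs : r ≤ s) (hc : 0 ≤ c) (hcs : c ≤ 2 * s) :
    |(1 / (r ^ 2 * s) - 2 * c / (r ^ 3 * s ^ 2)
      - 2 * c ^ 2 / (r ^ 2 * s ^ 3))
      + (-1 / (r ^ 2 * s ^ 3) - 3 * c / (r * s ^ 4))| ≤ 20 / (r ^ 2 * s) := by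
  have hr0 : 0 < r := by linarith
  have hs0 : 0 < s := by linarith
  have hs1 : 1 ≤ s := by linarith
  have b1 : 2 * c / (r ^ 3 * s ^ 2) ≤ 4 / (r ^ 2 * s) := by
    rw [div_le_div_iff₀ (by positivity) (by positivity)]
    have : c * 1 ≤ 2 * s * r := by gcongr
    have h : 0 ≤ r ^ 2 * s := by positivity
    nlinarith [mul_le_mul_of_nonneg_right this h]
  have b2 : 2 * c ^ 2 / (r ^ 2 * s ^ 3) ≤ 8 / (r ^ 2 * s) := by
    rw [div_le_div_iff₀ (by positivity) (by positivity)]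
    have : c ^ 2 ≤ (2 * s) ^ 2 := by gcongr
    have h : 0 ≤ r ^ 2 * s := by positivity
    nlinarith [mul_le_mul_of_nonneg_right this h]
  have b3 : 1 / (r ^ 2 * s ^ 3) ≤ 1 / (r ^ 2 * s) := by
    gcongr
    exact le_self_pow₀ hs1 (by norm_num)
  have b4 : 3 * c / (r * s ^ 4) ≤ 6 / (r ^ 2 * s) := by
    rw [div_le_div_iff₀ (by positivity) (by positivity)]
    have : c * r ≤ (2 * s) * s ^ 2 := by
      have : s ≤ s ^ 2 := by nlinarith
      have : r ≤ s ^ 2 := by linarith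
      gcongr
    have h : 0 ≤ r * s := by positivity
    nlinarith [mul_le_mul_of_nonneg_right this h]
  have p1 : 0 ≤ 2 * c / (r ^ 3 * s ^ 2) := by positivity
  have p2 : 0 ≤ 2 * c ^ 2 / (r ^ 2 * s ^ 3) := by positivity
  have p3 : 0 ≤ 1 / (r ^ 2 * s ^ 3) := by positivity
  have p4 : 0 ≤ 3 * c / (r * s ^ 4) := by positivity
  have p5 : 0 ≤ 1 / (r ^ 2 * s) := by positivity
  have q1 : -1 / (r ^ 2 * s ^ 3) = - (1 / (r ^ 2 * s ^ 3)) := by ring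
  have q2 : 4 / (r ^ 2 * s) = 4 * (1 / (r ^ 2 * s)) := by ring
  have q3 : 8 / (r ^ 2 * s) = 8 * (1 / (r ^ 2 * s)) := by ring
  have q4 : 6 / (r ^ 2 * s) = 6 * (1 / (r ^ 2 * s)) := by ring
  have q5 : 20 / (r ^ 2 * s) = 20 * (1 / (r ^ 2 * s)) := by ring
  rw [q1, q5]
  rw [q2] at b1
  rw [q3] at b2
  rw [q4] at b4
  rw [abs_le]
  constructor <;> linarith

lemma FF_lip {m p q : ℝ} (hm : 1 ≤ m) (hp : m ≤ p) (hq : m ≤ q) :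
    |FF q - FF p| ≤ 21 / (m * Real.sinh m ^ 2) * |q - p| := by
  have := (convex_Ici m).norm_image_sub_le_of_norm_hasDerivWithin_le (f := FF)
    (C := 21 / (m * Real.sinh m ^ 2)) (x := p) (y := q)
    (fun r hr => (FF_deriv (le_trans hm hr)).hasDerivWithinAt) ?_ hp hq
  · simpa [Real.norm_eq_abs] using this
  · intro r hr
    have hr1 : 1 ≤ r := le_trans hm hr
    rw [Real.norm_eq_abs]
    refine (alg_F hr1 (self_le_sinh' hr1) (Real.cosh_pos r).le (cosh_le_two_sinh hr1)).trans ?_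
    have h1 := self_le_sinh' hm
    have h2 : Real.sinh m ≤ Real.sinh r := Real.sinh_le_sinh.2 hr
    have h3 : m ≤ r := hr
    have h4 : 0 < Real.sinh m := by linarith
    gcongr

lemma HH_lip {m p q : ℝ} (hm : 1 ≤ m) (hp : m ≤ p) (hq : m ≤ q) :
    |HH q - HH p| ≤ 20 / (m ^ 2 * Real.sinh m) * |q - p| := by
  have := (convex_Ici m).norm_image_sub_le_of_norm_hasDerivWithin_le (f := HH)
    (C := 20 / (m ^ 2 * Real.sinh m)) (x := p) (y := q)
    (fun r hr => (HH_deriv (le_trans hm hr)).hasDerivWithinAt) ?_ hp hq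
  · simpa [Real.norm_eq_abs] using this
  · intro r hr
    have hr1 : 1 ≤ r := le_trans hm hr
    rw [Real.norm_eq_abs]
    refine (alg_H hr1 (self_le_sinh' hr1) (Real.cosh_pos r).le (cosh_le_two_sinh hr1)).trans ?_
    have h1 := self_le_sinh' hm
    have h2 : Real.sinh m ≤ Real.sinh r := Real.sinh_le_sinh.2 hr
    have h3 : m ≤ r := hr
    have h4 : 0 < Real.sinh m := by linarith
    gcongr

lemma cosh_sub_ge {m p q : ℝ} (hm : 0 ≤ m) (hp : m ≤ p) (hpq : p ≤ q) :
    Real.sinh m * (q - p) ≤ Real.cosh q - Real.cosh p := by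
  have := (convex_Ici m).mul_sub_le_image_sub_of_le_deriv (f := Real.cosh) (C := Real.sinh m)
    Real.continuous_cosh.continuousOn Real.differentiable_cosh.differentiableOn ?_
    p hp q (hp.trans hpq) hpq
  · exact this
  · intro r hr
    rw [interior_Ici] at hr
    rw [Real.deriv_cosh]
    exact Real.sinh_le_sinh.2 (le_of_lt hr)

lemma abs_sub_le_cosh {m p q : ℝ} (hm : 0 < m) (hp : m ≤ p) (hq : m ≤ q) :
    |q - p| ≤ |Real.cosh q - Real.cosh p| / Real.sinh m := by
  have hs : 0 < Real.sinh m := Real.sinh_pos_iff.2 hm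
  rw [le_div_iff₀ hs]
  rcases le_total p q with h | h
  · have := cosh_sub_ge hm.le hp h
    rw [abs_of_nonneg (by linarith : 0 ≤ q - p)]
    have := le_abs_self (Real.cosh q - Real.cosh p)
    linarith
  · have := cosh_sub_ge hm.le hq h
    rw [abs_of_nonpos (by linarith : q - p ≤ 0)]
    have := neg_le_abs (Real.cosh q - Real.cosh p)
    linarith

lemma rD_eq (p : ℝ × ℝ × ℝ) : rD p = Real.arcosh (chD p) := rfl

lemma one_le_chD {p : ℝ × ℝ × ℝ} (hp : 0 < p.2.2) : 1 ≤ chD p := by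
  unfold chD
  have h1 : p.2.2 * (p.2.2)⁻¹ = 1 := mul_inv_cancel₀ hp.ne'
  have h2 : 0 < (p.2.2)⁻¹ := by positivity
  have h3 : 0 ≤ (p.2.2)⁻¹ * (p.1 ^ 2 + p.2.1 ^ 2) := by positivity
  nlinarith [sq_nonneg (p.2.2 - (p.2.2)⁻¹), sq_nonneg (p.2.2 + (p.2.2)⁻¹)]

lemma cosh_rD {p : ℝ × ℝ × ℝ} (hp : 0 < p.2.2) : Real.cosh (rD p) = chD p := by
  rw [rD_eq, Real.cosh_arcosh (one_le_chD hp)]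

lemma rD_nonneg {p : ℝ × ℝ × ℝ} (hp : 0 < p.2.2) : 0 ≤ rD p := by
  rw [rD_eq]; exact Real.arcosh_nonneg (one_le_chD hp)

lemma k0_eq (p : ℝ × ℝ × ℝ) (hr : 1 ≤ rD p) :
    k0 p = (2 * Real.pi ^ 2)⁻¹ * (-FF (rD p) + (p.2.2)⁻¹ * HH (rD p)) := by
  have hs := self_le_sinh' hr
  have hr0 : rD p ≠ 0 := by positivity
  have hs0 : Real.sinh (rD p) ≠ 0 := by linarith
  unfold k0 FF HH
  field_simp

/-- comparability of the distances -/
lemma chD_comp {L : ℝ} (hL : 1 ≤ L) {t : ℝ} (ht0 : 0 ≤ t) (htL : t ≤ L) {x1 x2 a y1 y2 b : ℝ}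
    (ha : 0 < a) (hb : 0 < b) (hb3 : b ≤ 3) (hb3' : 1 / 3 ≤ b) (hy1 : |y1| ≤ 1) (hy2 : |y2| ≤ 1) :
    chD (x1, x2, a) ≤ 33 * L ^ 2 * chD (ginvMul (y1, y2, b) (x1 - t, x2, a)) := by
  unfold chD ginvMul
  simp only
  have e : (a / b + (a / b)⁻¹ + (a / b)⁻¹ * ((b⁻¹ * (x1 - t - y1)) ^ 2 + (b⁻¹ * (x2 - y2)) ^ 2)) / 2
      = (a ^ 2 + b ^ 2 + ((x1 - t - y1) ^ 2 + (x2 - y2) ^ 2)) / (2 * a * b) := by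
    field_simp
  have e2 : (a + a⁻¹ + a⁻¹ * (x1 ^ 2 + x2 ^ 2)) / 2 = (a ^ 2 + 1 + (x1 ^ 2 + x2 ^ 2)) / (2 * a) := by
    field_simp
  rw [e, e2, ← mul_div_assoc, div_le_div_iff₀ (by positivity) (by positivity)]
  rw [abs_le] at hy1 hy2
  have hT : (t + y1) ^ 2 ≤ 4 * L ^ 2 := by nlinarith
  have hY : y2 ^ 2 ≤ L ^ 2 := by nlinarith
  have hL2 : 1 ≤ L ^ 2 := by nlinarith
  set Z1 := x1 - t - y1 with hZ1
  set Z2 := x2 - y2 with hZ2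
  have hx1 : x1 ^ 2 ≤ 2 * Z1 ^ 2 + 2 * (t + y1) ^ 2 := by
    have : x1 = Z1 + (t + y1) := by rw [hZ1]; ring
    rw [this]; nlinarith [sq_nonneg (Z1 - (t + y1))]
  have hx2 : x2 ^ 2 ≤ 2 * Z2 ^ 2 + 2 * y2 ^ 2 := by
    have : x2 = Z2 + y2 := by rw [hZ2]; ring
    rw [this]; nlinarith [sq_nonneg (Z2 - y2)]
  have h1 : a ^ 2 + 1 + (x1 ^ 2 + x2 ^ 2) ≤ a ^ 2 + 11 * L ^ 2 + 2 * (Z1 ^ 2 + Z2 ^ 2) := by linarith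
  have h2 : (a ^ 2 + 11 * L ^ 2 + 2 * (Z1 ^ 2 + Z2 ^ 2)) * b
      ≤ 33 * L ^ 2 * (a ^ 2 + b ^ 2 + (Z1 ^ 2 + Z2 ^ 2)) := by
    have i1 : a ^ 2 * b ≤ 33 * L ^ 2 * a ^ 2 := by
      have : a ^ 2 * b ≤ a ^ 2 * (33 * L ^ 2) :=
        mul_le_mul_of_nonneg_left (by linarith) (sq_nonneg a)
      linarith
    have i2 : (Z1 ^ 2 + Z2 ^ 2) * (2 * b) ≤ (Z1 ^ 2 + Z2 ^ 2) * (33 * L ^ 2) := by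
      apply mul_le_mul_of_nonneg_left (by linarith) (by positivity)
    have i3 : 11 * L ^ 2 * b ≤ 33 * L ^ 2 * b ^ 2 := by
      have : b ≤ 3 * b ^ 2 := by nlinarith only [hb, hb3']
      have := mul_le_mul_of_nonneg_left this (by positivity : 0 ≤ 11 * L ^ 2)
      linarith
    linarith
  have h3 := mul_le_mul_of_nonneg_right h1 hb.le
  have h4 := mul_le_mul_of_nonneg_right (h3.trans h2) (by positivity : 0 ≤ 2 * a)
  linarith

lemma chD_diff {L : ℝ} (hL : 1 ≤ L) {x1 x2 a y1 y2 b : ℝ}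
    (ha : 0 < a) (hb : 0 < b) (hb3' : 1 / 3 ≤ b) (hy1 : |y1| ≤ 1) :
    |chD (ginvMul (y1, y2, b) (x1 - L, x2, a)) - chD (ginvMul (y1, y2, b) (x1, x2, a))|
      ≤ 5 * L ^ 2 * (1 + nm (x1, x2, a)) / a := by
  have hn : |x1| ≤ nm (x1, x2, a) := by
    unfold nm
    apply Real.abs_le_sqrt
    simp only
    nlinarith [sq_nonneg x2]
  set n := nm (x1, x2, a)
  have e : chD (ginvMul (y1, y2, b) (x1 - L, x2, a)) - chD (ginvMul (y1, y2, b) (x1, x2, a))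
      = (L ^ 2 - 2 * L * (x1 - y1)) / (2 * a * b) := by
    unfold chD ginvMul
    simp only
    field_simp
    ring
  rw [e, abs_div, abs_of_pos (by positivity : 0 < 2 * a * b), div_le_div_iff₀ (by positivity) ha]
  have hn0 : 0 ≤ n := (abs_nonneg _).trans hn
  have h1 : |L ^ 2 - 2 * L * (x1 - y1)| ≤ 3 * L ^ 2 * (1 + n) := by
    rw [abs_le] at hn hy1 ⊢
    have hL2 : L ≤ L ^ 2 := by nlinarith
    have j1 : L * (1 + n) ≤ L ^ 2 * (1 + n) := by gcongr
    have j2 : L * (x1 - y1) ≤ L * (1 + n) := by gcongr; linarith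
    have j3 : L * (-(1 + n)) ≤ L * (x1 - y1) := by gcongr; linarith
    have j4 : 0 ≤ L ^ 2 * n := by positivity
    constructor <;> nlinarith
  have h2 : 3 * L ^ 2 * (1 + n) * 1 ≤ 5 * L ^ 2 * (1 + n) * (2 * b) := by
    have : 0 ≤ L ^ 2 * (1 + n) := by positivity
    nlinarith
  nlinarith

lemma dist_comp {L r m : ℝ} (hL : 9 ≤ L) (hl : 8 ≤ Real.log L) (hr : Real.log L ^ 2 < r)
    (hm : 0 ≤ m) (h : Real.cosh r ≤ 33 * L ^ 2 * Real.cosh m) :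
    r / 2 ≤ m ∧ Real.sinh r ≤ 66 * L ^ 2 * Real.sinh m := by
  have hL0 : 0 < L := by linarith
  have h1 : r / 2 ≤ m := by
    have hexp : L ^ 4 ≤ Real.exp (r / 2) := by
      have : L ^ 4 = Real.exp (4 * Real.log L) := by
        rw [show 4 * Real.log L = ((4:ℕ):ℝ) * Real.log L by norm_num, Real.exp_nat_mul,
          Real.exp_log hL0]
      rw [this]
      apply Real.exp_le_exp.2
      nlinarith
    have hL4 : 66 * L ^ 2 ≤ L ^ 4 := by
      have : 66 ≤ L ^ 2 := by nlinarith
      nlinarith [sq_nonneg L]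
    have hr0 : 0 < r := by nlinarith
    have hc1 : Real.exp r / 2 ≤ Real.cosh r := by
      rw [Real.cosh_eq]; have := Real.exp_pos (-r); linarith
    have hc2 : Real.cosh (r / 2) ≤ Real.exp (r / 2) := by
      rw [Real.cosh_eq]
      have : Real.exp (-(r / 2)) ≤ Real.exp (r / 2) := Real.exp_le_exp.2 (by linarith)
      linarith
    have hee : Real.exp r = Real.exp (r / 2) * Real.exp (r / 2) := by
      rw [← Real.exp_add]; ring_nf
    have hE := Real.exp_pos (r / 2)
    have : Real.cosh (r / 2) ≤ Real.cosh m := by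
      have k1 : 33 * L ^ 2 * Real.exp (r / 2) ≤ 33 * L ^ 2 * Real.cosh m := by
        have : 66 * L ^ 2 * Real.exp (r / 2) ≤ Real.exp (r / 2) * Real.exp (r / 2) := by
          apply mul_le_mul_of_nonneg_right _ hE.le
          linarith
        linarith
      have := le_of_mul_le_mul_left k1 (by positivity)
      linarith
    have := Real.cosh_le_cosh.1 this
    rwa [abs_of_pos (by linarith), abs_of_nonneg hm] at this
  refine ⟨h1, ?_⟩
  have hm1 : 1 ≤ m := by nlinarith
  have h3 := cosh_le_two_sinh hm1
  have h4 : Real.sinh r ≤ Real.cosh r := (Real.sinh_lt_cosh r).le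
  have h5 : 33 * L ^ 2 * Real.cosh m ≤ 33 * L ^ 2 * (2 * Real.sinh m) := by gcongr
  linarith

lemma final_alg {L r S m s a n D b A B : ℝ} (hL : 1 ≤ L) (hr : 1 ≤ r) (hS : 0 < S)
    (hm : r / 2 ≤ m) (hs : S ≤ 66 * L ^ 2 * s) (ha : 0 < a) (hn : 0 ≤ n)
    (hb : 0 < b) (hb3 : b ≤ 3) (hD0 : 0 ≤ D)
    (hD : D ≤ 5 * L ^ 2 * (1 + n) / a)
    (hA : A ≤ 21 / (m * s ^ 2) * (D / s)) (hB : B ≤ 20 / (m ^ 2 * s) * (D / s)) :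
    A + (a / b)⁻¹ * B ≤ 100000000 * L ^ 8 * ((1 + n) / (a * r * S ^ 3) +
      (1 + n) / (a ^ 2 * r ^ 2 * S ^ 2)) := by
  have hL0 : 0 < L := by linarith
  have hr0 : 0 < r := by linarith
  have hs' : S / (66 * L ^ 2) ≤ s := by rw [div_le_iff₀ (by positivity)]; linarith
  have hs0 : 0 < s := lt_of_lt_of_le (by positivity) hs'
  have hm0 : 0 < m := by linarith
  have hA' : A ≤ 60374160 * L ^ 8 * ((1 + n) / (a * r * S ^ 3)) := by
    calc A ≤ 21 / (m * s ^ 2) * (D / s) := hA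
      _ ≤ 21 / ((r / 2) * (S / (66 * L ^ 2)) ^ 2) *
          ((5 * L ^ 2 * (1 + n) / a) / (S / (66 * L ^ 2))) := by
          gcongr
      _ = 60374160 * L ^ 8 * ((1 + n) / (a * r * S ^ 3)) := by
          field_simp; ring
  have hB' : B ≤ 1742400 * L ^ 6 * ((1 + n) / (a * r ^ 2 * S ^ 2)) := by
    calc B ≤ 20 / (m ^ 2 * s) * (D / s) := hB
      _ ≤ 20 / ((r / 2) ^ 2 * (S / (66 * L ^ 2))) *
          ((5 * L ^ 2 * (1 + n) / a) / (S / (66 * L ^ 2))) := by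
          gcongr
      _ = 1742400 * L ^ 6 * ((1 + n) / (a * r ^ 2 * S ^ 2)) := by
          field_simp; ring
  have hB'' : (a / b)⁻¹ * B ≤ 100000000 * L ^ 8 * ((1 + n) / (a ^ 2 * r ^ 2 * S ^ 2)) := by
    calc (a / b)⁻¹ * B ≤ (a / b)⁻¹ * (1742400 * L ^ 6 * ((1 + n) / (a * r ^ 2 * S ^ 2))) := by
          gcongr
      _ = b * 1742400 * L ^ 6 * ((1 + n) / (a ^ 2 * r ^ 2 * S ^ 2)) := by
          field_simp
      _ ≤ 100000000 * L ^ 8 * ((1 + n) / (a ^ 2 * r ^ 2 * S ^ 2)) := by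
          gcongr
          · linarith
          · norm_num
  have hA'' : A ≤ 100000000 * L ^ 8 * ((1 + n) / (a * r * S ^ 3)) := by
    refine hA'.trans ?_
    gcongr
    norm_num
  linarith

/-- the difference estimate for `k₀` in the region `r(x) > (log L)²`. -/
theorem stmt12 :
    ∃ C N : ℝ, 0 < C ∧ 0 < N ∧ ∀ L : ℝ, C ≤ L →
      ∀ x : ℝ × ℝ × ℝ, 0 < x.2.2 → (Real.log L) ^ 2 < rD x → ∀ y ∈ P0,
        |k0 (ginvMul y (x.1 - L, x.2.1, x.2.2)) - k0 (ginvMul y x)| ≤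
          C * L ^ N *
            ((1 + nm x) / (x.2.2 * rD x * Real.sinh (rD x) ^ 3) +
              (1 + nm x) / (x.2.2 ^ 2 * rD x ^ 2 * Real.sinh (rD x) ^ 2)) := by
  refine ⟨100000000, 8, by norm_num, by norm_num, ?_⟩
  rintro L hL ⟨x1, x2, a⟩ ha hr ⟨y1, y2, b⟩ ⟨hy1, hy2, hb1, hb2⟩
  simp only at ha hy1 hy2 hb1 hb2 ⊢
  have hexp : Real.exp 1 < 2.72 := lt_trans Real.exp_one_lt_d9 (by norm_num)
  have hL0 : 0 < L := by linarith
  have hl : 8 ≤ Real.log L := by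
    rw [Real.le_log_iff_exp_le hL0]
    have : Real.exp 8 = Real.exp 1 ^ 8 := by rw [← Real.exp_nat_mul]; norm_num
    rw [this]
    have : Real.exp 1 ^ 8 ≤ 2.72 ^ 8 := by gcongr
    norm_num at this
    linarith
  have hb0 : 0 < b := lt_of_lt_of_le (Real.exp_pos _) hb1
  have hb3 : b ≤ 3 := by linarith
  have hb3' : 1 / 3 ≤ b := by
    refine le_trans ?_ hb1
    rw [Real.exp_neg, ← one_div]
    apply one_div_le_one_div_of_le (Real.exp_pos _)
    linarith
  have hy1' : |y1| ≤ 1 := abs_le.2 hy1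
  have hy2' : |y2| ≤ 1 := abs_le.2 hy2
  have hL1 : 1 ≤ L := by linarith
  have c0 := chD_comp hL1 le_rfl hL0.le (x1 := x1) (x2 := x2) ha hb0 hb3 hb3' hy1' hy2'
  have cL := chD_comp hL1 hL0.le le_rfl (x1 := x1) (x2 := x2) ha hb0 hb3 hb3' hy1' hy2'
  have cd := chD_diff hL1 (x1 := x1) (x2 := x2) (y2 := y2) ha hb0 hb3' hy1'
  rw [sub_zero] at c0
  have hpa : 0 < (ginvMul (y1, y2, b) (x1, x2, a)).2.2 := div_pos ha hb0
  have hqa : 0 < (ginvMul (y1, y2, b) (x1 - L, x2, a)).2.2 := div_pos ha hb0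
  have epa : (ginvMul (y1, y2, b) (x1, x2, a)).2.2 = a / b := rfl
  have eqa : (ginvMul (y1, y2, b) (x1 - L, x2, a)).2.2 = a / b := rfl
  generalize ginvMul (y1, y2, b) (x1, x2, a) = P at *
  generalize ginvMul (y1, y2, b) (x1 - L, x2, a) = Q at *
  have hn : 0 ≤ nm (x1, x2, a) := Real.sqrt_nonneg _
  rw [← cosh_rD (p := (x1, x2, a)) ha, ← cosh_rD hpa] at c0
  rw [← cosh_rD (p := (x1, x2, a)) ha, ← cosh_rD hqa] at cL
  rw [← cosh_rD hpa, ← cosh_rD hqa] at cd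
  have hp0 := rD_nonneg hpa
  have hq0 := rD_nonneg hqa
  generalize nm (x1, x2, a) = n at *
  generalize rD (x1, x2, a) = r at *
  have dm : ∃ m, m ≤ rD P ∧ m ≤ rD Q ∧ r / 2 ≤ m ∧ Real.sinh r ≤ 66 * L ^ 2 * Real.sinh m := by
    obtain ⟨u1, u2⟩ := dist_comp (by linarith) hl hr hp0 c0
    obtain ⟨v1, v2⟩ := dist_comp (by linarith) hl hr hq0 cL
    rcases le_total (rD P) (rD Q) with h | h
    · exact ⟨_, le_rfl, h, u1, u2⟩
    · exact ⟨_, h, le_rfl, v1, v2⟩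
  obtain ⟨m, hmP, hmQ, hm, hms⟩ := dm
  have hr64 : 64 < r := by nlinarith
  have hm1 : 1 ≤ m := by linarith
  have hS : 0 < Real.sinh r := Real.sinh_pos_iff.2 (by linarith)
  have hs : 0 < Real.sinh m := Real.sinh_pos_iff.2 (by linarith)
  have dd := abs_sub_le_cosh (by linarith) hmP hmQ
  have hF := FF_lip hm1 hmP hmQ
  have hH := HH_lip hm1 hmP hmQ
  have hF' := hF.trans (mul_le_mul_of_nonneg_left dd (by positivity))
  have hH' := hH.trans (mul_le_mul_of_nonneg_left dd (by positivity))
  have key := final_alg hL1 (by linarith) hS hm hms ha hn hb0 hb3 (abs_nonneg _) cd hF' hH'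
  have e8 : L ^ (8:ℝ) = L ^ (8:ℕ) := by
    rw [← Real.rpow_natCast]; norm_num
  rw [e8]
  refine le_trans ?_ key
  rw [k0_eq P (by linarith), k0_eq Q (by linarith), epa, eqa]
  have hpi : (2 * Real.pi ^ 2)⁻¹ ≤ 1 := by
    apply inv_le_one_of_one_le₀
    nlinarith [Real.pi_gt_three]
  have hpi0 : 0 ≤ (2 * Real.pi ^ 2)⁻¹ := by positivity
  have hab : 0 ≤ (a / b)⁻¹ := by positivity
  have e : (2 * Real.pi ^ 2)⁻¹ * (-FF (rD Q) + (a / b)⁻¹ * HH (rD Q))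
      - (2 * Real.pi ^ 2)⁻¹ * (-FF (rD P) + (a / b)⁻¹ * HH (rD P))
      = (2 * Real.pi ^ 2)⁻¹ * (-(FF (rD Q) - FF (rD P)) + (a / b)⁻¹ * (HH (rD Q) - HH (rD P))) := by
    ring
  rw [e, abs_mul, abs_of_nonneg hpi0]
  calc (2 * Real.pi ^ 2)⁻¹ * |(-(FF (rD Q) - FF (rD P)) + (a / b)⁻¹ * (HH (rD Q) - HH (rD P)))|
      ≤ 1 * |(-(FF (rD Q) - FF (rD P)) + (a / b)⁻¹ * (HH (rD Q) - HH (rD P)))| := by gcongr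
    _ ≤ |-(FF (rD Q) - FF (rD P))| + |(a / b)⁻¹ * (HH (rD Q) - HH (rD P))| := by
        rw [one_mul]; exact abs_add_le _ _
    _ = _ := by rw [abs_neg, abs_mul, abs_of_nonneg hab]
end
end

section
/- There exists a constant C > 0 such that for every R ≥ 1 one has ∫_{{x ∈ G : r(x) > R}} a⁻¹ (1+|x|) / sinh³ r(x) dρ(x) ≤ C e^{−R}. -/
open Real MeasureTheory Set

noncomputable section

lemma inner_lint (b s0 : ℝ) (hb : 0 < b) (hs : 0 ≤ s0) :
    ∫⁻ s in Ioi s0, ENNReal.ofReal (s * (b + s ^ 2) ^ (-(5/2) : ℝ))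
      = ENNReal.ofReal ((1/3) * (b + s0 ^ 2) ^ (-(3/2) : ℝ)) := by
  have hd : ∀ x ∈ Ici s0, HasDerivAt (fun s : ℝ => -(1/3) * (b + s ^ 2) ^ (-(3/2) : ℝ))
      (x * (b + x ^ 2) ^ (-(5/2) : ℝ)) x := by
    intro x _
    have h1 : HasDerivAt (fun s : ℝ => b + s ^ 2) (2 * x) x := by
      simpa using (hasDerivAt_pow 2 x).const_add b
    have h2 := (h1.rpow_const (p := (-(3/2) : ℝ)) (Or.inl (by positivity))).const_mul (-(1/3) : ℝ)
    rw [show (-(3/2) - 1 : ℝ) = -(5/2) by norm_num] at h2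
    have e : x * (b + x ^ 2) ^ (-(5/2) : ℝ) =
        -(1/3) * (2 * x * -(3/2) * (b + x ^ 2) ^ (-(5/2) : ℝ)) := by ring
    rw [e]
    exact h2
  have hn : ∀ x ∈ Ioi s0, 0 ≤ x * (b + x ^ 2) ^ (-(5/2) : ℝ) := by
    intro x hx
    have : 0 < x := lt_of_le_of_lt hs hx
    positivity
  have ht : Filter.Tendsto (fun s : ℝ => -(1/3) * (b + s ^ 2) ^ (-(3/2) : ℝ)) Filter.atTop
      (nhds (-(1/3) * 0)) := by
    apply Filter.Tendsto.const_mul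
    apply (tendsto_rpow_neg_atTop (by norm_num : (0:ℝ) < 3/2)).comp
    exact Filter.tendsto_atTop_add_const_left _ _ (Filter.tendsto_pow_atTop two_ne_zero)
  have hi := integrableOn_Ioi_deriv_of_nonneg' hd hn ht
  have he := integral_Ioi_of_hasDerivAt_of_nonneg' hd hn ht
  rw [← ofReal_integral_eq_lintegral_ofReal hi
    ((ae_restrict_iff' measurableSet_Ioi).2 (Filter.Eventually.of_forall hn)), he]
  congr 1
  ring

lemma plane_lint (a T : ℝ) (ha : 0 < a) (hT : 0 < T) :
    ∫⁻ z : ℝ × ℝ, ({z : ℝ × ℝ | 2 * a * T < 1 + a ^ 2 + (z.1 ^ 2 + z.2 ^ 2)}.indicator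
      (fun z => ENNReal.ofReal ((1 + a ^ 2 + (z.1 ^ 2 + z.2 ^ 2)) ^ (-(5/2) : ℝ)))) z
      ≤ ENNReal.ofReal (2 * π * ((1/3) * (max (1 + a ^ 2) (2 * a * T)) ^ (-(3/2) : ℝ))) := by
  rw [← lintegral_comp_polarCoord_symm, polarCoord_target]
  set s0 := √(max 0 (2 * a * T - (1 + a ^ 2))) with hs0
  have hsq : s0 ^ 2 = max 0 (2 * a * T - (1 + a ^ 2)) := Real.sq_sqrt (le_max_left _ _)
  have hpt : ∀ p ∈ Ioi (0:ℝ) ×ˢ Ioo (-π) π, ENNReal.ofReal p.1 •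
      ({z : ℝ × ℝ | 2 * a * T < 1 + a ^ 2 + (z.1 ^ 2 + z.2 ^ 2)}.indicator
      (fun z => ENNReal.ofReal ((1 + a ^ 2 + (z.1 ^ 2 + z.2 ^ 2)) ^ (-(5/2) : ℝ))))
        (polarCoord.symm p) ≤ (Ioi s0).indicator
          (fun s => ENNReal.ofReal (s * (1 + a ^ 2 + s ^ 2) ^ (-(5/2) : ℝ))) p.1 * 1 := by
    rintro ⟨s, θ⟩ ⟨hs, -⟩
    have hs : 0 < s := hs
    have e : (s * cos θ) ^ 2 + (s * sin θ) ^ 2 = s ^ 2 := by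
      nlinarith [Real.sin_sq_add_cos_sq θ]
    simp only [polarCoord_symm_apply, indicator, mem_ofPred_eq, e, mul_one, smul_eq_mul]
    split_ifs with h1 h2 h2
    · rw [← ENNReal.ofReal_mul hs.le]
    · exfalso
      apply h2
      rw [mem_Ioi, hs0, Real.sqrt_lt' hs]
      exact max_lt (by positivity) (by linarith)
    · simp
    · simp
  refine (setLIntegral_mono' (measurableSet_Ioi.prod measurableSet_Ioo) hpt).trans ?_
  rw [Measure.volume_eq_prod, ← Measure.prod_restrict,
    lintegral_prod_mul (f := (Ioi s0).indicator
      (fun s => ENNReal.ofReal (s * (1 + a ^ 2 + s ^ 2) ^ (-(5/2) : ℝ)))) (g := fun _ => 1)]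
  · rw [lintegral_indicator measurableSet_Ioi, Measure.restrict_restrict measurableSet_Ioi,
      Ioi_inter_Ioi, max_eq_left (Real.sqrt_nonneg _), inner_lint _ _ (by positivity)
      (Real.sqrt_nonneg _), hsq]
    simp only [lintegral_const, Measure.restrict_apply_univ, Real.volume_Ioo, one_mul]
    rw [← ENNReal.ofReal_mul (by positivity)]
    apply ENNReal.ofReal_le_ofReal
    have : 1 + a ^ 2 + max 0 (2 * a * T - (1 + a ^ 2)) = max (1 + a ^ 2) (2 * a * T) := by
      rw [← max_add_add_left]; congr 1 <;> ring
    rw [this]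
    apply le_of_eq; ring
  · exact ((by fun_prop : Measurable fun s : ℝ =>
      ENNReal.ofReal (s * (1 + a ^ 2 + s ^ 2) ^ (-(5/2) : ℝ))).indicator
        measurableSet_Ioi).aemeasurable
  · exact aemeasurable_const

lemma outer_lint (T : ℝ) (hT : 0 < T) :
    ∫⁻ a in Ioi (0:ℝ), ENNReal.ofReal (a * (max (1 + a ^ 2) (2 * a * T)) ^ (-(3/2) : ℝ))
      ≤ ENNReal.ofReal (3 / T) := by
  rw [← Ioc_union_Ioi_eq_Ioi hT.le]
  refine (lintegral_union_le _ _ _).trans ?_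
  have h1 : ∫⁻ a in Ioc 0 T, ENNReal.ofReal (a * (max (1 + a ^ 2) (2 * a * T)) ^ (-(3/2) : ℝ))
      ≤ ENNReal.ofReal (2 / T) := by
    have hb : ∀ a ∈ Ioc 0 T,
        ENNReal.ofReal (a * (max (1 + a ^ 2) (2 * a * T)) ^ (-(3/2) : ℝ)) ≤
        ENNReal.ofReal (a ^ (-(1/2) : ℝ) * T ^ (-(3/2) : ℝ)) := by
      rintro a ⟨ha, -⟩
      apply ENNReal.ofReal_le_ofReal
      have : (max (1 + a ^ 2) (2 * a * T)) ^ (-(3/2) : ℝ) ≤ (a * T) ^ (-(3/2) : ℝ) :=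
        Real.rpow_le_rpow_of_nonpos (by positivity)
          (le_max_of_le_right (by nlinarith [mul_pos ha hT])) (by norm_num)
      calc _ ≤ a * (a * T) ^ (-(3/2) : ℝ) := by gcongr
        _ = a ^ (1:ℝ) * a ^ (-(3/2) : ℝ) * T ^ (-(3/2) : ℝ) := by
          rw [Real.mul_rpow ha.le hT.le, Real.rpow_one]; ring
        _ = _ := by rw [← Real.rpow_add ha]; norm_num
    refine (setLIntegral_mono' measurableSet_Ioc hb).trans ?_
    have hi : IntegrableOn (fun a : ℝ => a ^ (-(1/2) : ℝ) * T ^ (-(3/2) : ℝ)) (Ioc 0 T) := by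
      have := (intervalIntegral.intervalIntegrable_rpow' (a := 0) (b := T)
        (r := (-(1/2) : ℝ)) (by norm_num)).mul_const (T ^ (-(3/2) : ℝ))
      rwa [intervalIntegrable_iff_integrableOn_Ioc_of_le hT.le] at this
    rw [← ofReal_integral_eq_lintegral_ofReal hi
      ((ae_restrict_iff' measurableSet_Ioc).2 (Filter.Eventually.of_forall
        (fun a ha => by have := ha.1; positivity)))]
    apply ENNReal.ofReal_le_ofReal
    rw [← intervalIntegral.integral_of_le hT.le, intervalIntegral.integral_mul_const,
      integral_rpow (Or.inl (by norm_num))]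
    have e : T ^ (1/2 : ℝ) * T ^ (-(3/2) : ℝ) = 1 / T := by
      rw [← Real.rpow_add hT]; norm_num [Real.rpow_neg_one]
    norm_num at e ⊢
    rw [div_mul_eq_mul_div, e]
    apply le_of_eq; field_simp
  have h2 : ∫⁻ a in Ioi T, ENNReal.ofReal (a * (max (1 + a ^ 2) (2 * a * T)) ^ (-(3/2) : ℝ))
      ≤ ENNReal.ofReal (1 / T) := by
    have hb : ∀ a ∈ Ioi T,
        ENNReal.ofReal (a * (max (1 + a ^ 2) (2 * a * T)) ^ (-(3/2) : ℝ)) ≤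
        ENNReal.ofReal (a ^ (-2 : ℝ)) := by
      intro a ha
      have ha : 0 < a := hT.trans ha
      apply ENNReal.ofReal_le_ofReal
      have : (max (1 + a ^ 2) (2 * a * T)) ^ (-(3/2) : ℝ) ≤ (a ^ (2:ℝ)) ^ (-(3/2) : ℝ) :=
        Real.rpow_le_rpow_of_nonpos (by positivity)
          (le_max_of_le_left (by norm_num)) (by norm_num)
      calc _ ≤ a * (a ^ (2:ℝ)) ^ (-(3/2) : ℝ) := by gcongr
        _ = a ^ (1:ℝ) * a ^ (2 * (-(3/2)) : ℝ) := by
          rw [Real.rpow_mul ha.le, Real.rpow_one]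
        _ = _ := by rw [← Real.rpow_add ha]; norm_num
    refine (setLIntegral_mono' measurableSet_Ioi hb).trans ?_
    have hi := integrableOn_Ioi_rpow_of_lt (by norm_num : (-2:ℝ) < -1) hT
    rw [← ofReal_integral_eq_lintegral_ofReal hi
      ((ae_restrict_iff' measurableSet_Ioi).2 (Filter.Eventually.of_forall
        (fun a ha => by have : 0 < a := hT.trans ha; positivity))),
      integral_Ioi_rpow_of_lt (by norm_num) hT]
    apply ENNReal.ofReal_le_ofReal
    norm_num [Real.rpow_neg_one]
  refine (add_le_add h1 h2).trans ?_
  rw [← ENNReal.ofReal_add (by positivity) (by positivity)]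
  apply ENNReal.ofReal_le_ofReal
  apply le_of_eq; ring

lemma pt_bound_s14 (p : ℝ × ℝ × ℝ) (R : ℝ) (hR : 1 ≤ R) (ha : 0 < p.2.2) (hr : R < rD p) :
    2 * p.2.2 * cosh R < 1 + p.2.2 ^ 2 + (p.1 ^ 2 + p.2.1 ^ 2) ∧
    (p.2.2)⁻¹ * ((p.2.2)⁻¹ * (1 + nm p) / Real.sinh (rD p) ^ 3) ≤
      128 * p.2.2 * (1 + p.2.2 ^ 2 + (p.1 ^ 2 + p.2.1 ^ 2)) ^ (-(5/2) : ℝ) := by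
  obtain ⟨x, y, a⟩ := p
  simp only [nm] at *
  set p : ℝ × ℝ × ℝ := (x, y, a)
  set q := 1 + a ^ 2 + (x ^ 2 + y ^ 2) with hq
  have hq0 : 0 < q := by positivity
  have hc : chD p = q / (2 * a) := by
    simp only [chD, p, hq]; field_simp; ring
  have hc1 : 1 ≤ chD p := by
    rw [hc, le_div_iff₀ (by positivity)]
    nlinarith [sq_nonneg (a - 1), sq_nonneg x, sq_nonneg y]
  have hrd : rD p = arcosh (chD p) := rfl
  have hch : cosh (rD p) = chD p := by rw [hrd, cosh_arcosh hc1]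
  have hlt : cosh R < chD p := by
    rw [← hch]
    exact Real.cosh_lt_cosh.2 (by rw [abs_of_pos (by linarith), abs_of_pos (by linarith)]; exact hr)
  have hR32 : 2 ≤ cosh R ^ 2 := by
    have h1 : R ≤ sinh R := Real.self_le_sinh_iff.2 (by linarith)
    rw [Real.cosh_sq]
    nlinarith
  refine ⟨?_, ?_⟩
  · rw [hc, lt_div_iff₀ (by positivity)] at hlt
    linarith
  have hs0 : 0 < sinh (rD p) := Real.sinh_pos_iff.2 (by linarith)
  have hs : q / (4 * a) ≤ sinh (rD p) := by
    have e : q / (4 * a) = chD p / 2 := by rw [hc]; field_simp; norm_num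
    rw [e]
    have h3 := Real.sinh_sq (rD p)
    rw [hch] at h3
    have h4 := Real.cosh_pos R
    have h5 : cosh R ^ 2 ≤ chD p ^ 2 := by gcongr
    apply abs_le_of_sq_le_sq' _ hs0.le |>.2
    nlinarith
  have hN : 1 + √(x ^ 2 + y ^ 2) ≤ 2 * q ^ (1/2 : ℝ) := by
    rw [← Real.sqrt_eq_rpow]
    have h1 : √(x ^ 2 + y ^ 2) ≤ √q := Real.sqrt_le_sqrt (by rw [hq]; nlinarith [sq_nonneg a])
    have h2 : 1 ≤ √q := Real.one_le_sqrt.2 (by rw [hq]; nlinarith [sq_nonneg a, sq_nonneg x, sq_nonneg y])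
    linarith
  have e2 : q ^ (-(5/2) : ℝ) = q ^ (1/2 : ℝ) / q ^ 3 := by
    rw [← Real.rpow_natCast q 3, ← Real.rpow_sub hq0]; norm_num
  calc a⁻¹ * (a⁻¹ * (1 + √(x ^ 2 + y ^ 2)) / sinh (rD p) ^ 3)
      ≤ a⁻¹ * (a⁻¹ * (2 * q ^ (1/2 : ℝ)) / (q / (4 * a)) ^ 3) := by gcongr
    _ = 128 * a * q ^ (-(5/2) : ℝ) := by
      rw [e2]; field_simp; norm_num

/-- `∫_{r(x) > R} a⁻¹ (1+|x|)/sinh³ r(x) dρ(x) ≲ e^{−R}` for `R ≥ 1`. -/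
theorem stmt14 :
    ∃ C : ℝ, 0 < C ∧ ∀ R : ℝ, 1 ≤ R →
      ∫⁻ p in {p : ℝ × ℝ × ℝ | 0 < p.2.2 ∧ R < rD p},
        ENNReal.ofReal ((p.2.2)⁻¹ * (1 + nm p) / Real.sinh (rD p) ^ 3) ∂ρG
        ≤ ENNReal.ofReal (C * Real.exp (-R)) := by
  refine ⟨512 * π, by positivity, fun R hR => ?_⟩
  have hT : 0 < cosh R := Real.cosh_pos R
  have hmr : Measurable rD := by unfold rD chD; fun_prop
  have hS : MeasurableSet {p : ℝ × ℝ × ℝ | 0 < p.2.2 ∧ R < rD p} :=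
    MeasurableSet.inter (s₁ := {p : ℝ × ℝ × ℝ | 0 < p.2.2}) (s₂ := {p : ℝ × ℝ × ℝ | R < rD p})
      (measurableSet_lt (by fun_prop) (by fun_prop)) (measurableSet_lt (by fun_prop) hmr)
  have hmf : Measurable fun p : ℝ × ℝ × ℝ =>
      ENNReal.ofReal ((p.2.2)⁻¹ * (1 + nm p) / Real.sinh (rD p) ^ 3) := by
    unfold nm; fun_prop
  let g : (ℝ × ℝ) × ℝ → ENNReal := fun w =>
    {w : (ℝ × ℝ) × ℝ | 2 * w.2 * cosh R < 1 + w.2 ^ 2 + (w.1.1 ^ 2 + w.1.2 ^ 2)}.indicator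
      (fun w => ENNReal.ofReal ((1 + w.2 ^ 2 + (w.1.1 ^ 2 + w.1.2 ^ 2)) ^ (-(5/2) : ℝ))) w
  have hg : Measurable g := Measurable.indicator (by fun_prop)
    (measurableSet_lt (by fun_prop) (by fun_prop))
  let F : (ℝ × ℝ) × ℝ → ENNReal := fun w =>
    (Ioi (0:ℝ)).indicator (fun a => ENNReal.ofReal (128 * a)) w.2 * g w
  have hF : Measurable F := by
    refine Measurable.mul ?_ hg
    exact (Measurable.indicator (by fun_prop) measurableSet_Ioi).comp measurable_snd
  rw [ρG, restrict_withDensity hS, lintegral_withDensity_eq_lintegral_mul _ (by fun_prop) hmf,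
    Measure.restrict_restrict hS]
  have hsub : {p : ℝ × ℝ × ℝ | 0 < p.2.2 ∧ R < rD p} ∩ {p | 0 < p.2.2} =
      {p : ℝ × ℝ × ℝ | 0 < p.2.2 ∧ R < rD p} := by
    ext p; simp only [mem_inter_iff, mem_ofPred_eq]; tauto
  rw [hsub]
  calc _ ≤ ∫⁻ p in {p : ℝ × ℝ × ℝ | 0 < p.2.2 ∧ R < rD p}, F (MeasurableEquiv.prodAssoc.symm p) := by
        refine setLIntegral_mono' hS ?_
        rintro p ⟨ha, hr⟩
        obtain ⟨h1, h2⟩ := pt_bound_s14 p R hR ha hr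
        have hF' : F (MeasurableEquiv.prodAssoc.symm p) = ENNReal.ofReal (128 * p.2.2 *
            (1 + p.2.2 ^ 2 + (p.1 ^ 2 + p.2.1 ^ 2)) ^ (-(5/2) : ℝ)) := by
          rw [ENNReal.ofReal_mul (by positivity)]
          simp only [F, g]
          rw [indicator_of_mem (by exact ha), indicator_of_mem (by exact h1)]
          rfl
        rw [hF', Pi.mul_apply, ← ENNReal.ofReal_mul (by positivity)]
        exact ENNReal.ofReal_le_ofReal h2
    _ ≤ ∫⁻ p, F (MeasurableEquiv.prodAssoc.symm p) := setLIntegral_le_lintegral _ _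
    _ = ∫⁻ w, F w := by
        exact (volume_preserving_prodAssoc (α₁ := ℝ) (β₁ := ℝ) (γ₁ := ℝ)).symm.lintegral_comp hF
    _ = ∫⁻ a, ∫⁻ z, F (z, a) := by
        rw [Measure.volume_eq_prod, lintegral_prod_symm _ hF.aemeasurable]
    _ ≤ ∫⁻ a in Ioi (0:ℝ), ENNReal.ofReal (256 * π / 3) *
          ENNReal.ofReal (a * (max (1 + a ^ 2) (2 * a * cosh R)) ^ (-(3/2) : ℝ)) := by
        rw [← lintegral_indicator measurableSet_Ioi]
        apply lintegral_mono
        intro a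
        by_cases ha : a ∈ Ioi (0:ℝ)
        · have ha' : 0 < a := ha
          simp only [F, indicator_of_mem ha]
          rw [lintegral_const_mul (f := fun z : ℝ × ℝ => g (z, a)) _
            (hg.comp (by fun_prop : Measurable fun z : ℝ × ℝ => (z, a)))]
          refine (mul_le_mul_right (plane_lint a (cosh R) ha hT) _).trans ?_
          rw [← ENNReal.ofReal_mul (by positivity), ← ENNReal.ofReal_mul (by positivity)]
          apply ENNReal.ofReal_le_ofReal
          apply le_of_eq; ring
        · simp [F, indicator_of_notMem ha]
    _ ≤ ENNReal.ofReal (256 * π / 3) * ENNReal.ofReal (3 / cosh R) := by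
        rw [lintegral_const_mul _ (by fun_prop)]
        exact mul_le_mul_right (outer_lint _ hT) _
    _ ≤ ENNReal.ofReal (512 * π * exp (-R)) := by
        rw [← ENNReal.ofReal_mul (by positivity)]
        apply ENNReal.ofReal_le_ofReal
        have h : 1 / cosh R ≤ 2 * exp (-R) := by
          rw [div_le_iff₀ hT, Real.cosh_eq]
          have : exp R * exp (-R) = 1 := by rw [← Real.exp_add]; simp
          nlinarith [Real.exp_pos (-R)]
        calc _ = 256 * π * (1 / cosh R) := by ring
          _ ≤ 256 * π * (2 * exp (-R)) := by gcongr
          _ = _ := by ring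
end
end
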